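/- Let L be a Lelek fan and Y a non-degenerate continuum. The following are equivalent: (1) there is an embedding e : Y → L admitting an open retraction from L onto e(Y); (2) there is an open continuous surjection f : L → Y; (3) Y is a Lelek fan. -/

import Mathlib

open Set Topology Filter

section Defs
variable {X : Type*} [TopologicalSpace X]

def IsSubcontinuum (A : Set X) : Prop := IsCompact A ∧ IsConnected A

def IsArc (A : Set X) : Prop := Nonempty (A ≃ₜ (Set.Icc (0:ℝ) 1))

def IsEndpointOfArc (A : Set X) (x : X) : Prop :=
  ∃ φ : (Set.Icc (0:ℝ) 1) ≃ₜ A, ((φ ⟨0, by norm_num⟩ : A) : X) = x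

def IsArcFromTo (A : Set X) (x y : X) : Prop :=
  (x = y ∧ A = {x}) ∨ (x ≠ y ∧ IsArc A ∧ IsEndpointOfArc A x ∧ IsEndpointOfArc A y)

def IsArcwiseConnected (K : Set X) : Prop :=
  ∀ x ∈ K, ∀ y ∈ K, x ≠ y →
    ∃ A, A ⊆ K ∧ IsArc A ∧ IsEndpointOfArc A x ∧ IsEndpointOfArc A y

def IsUnicoherent (K : Set X) : Prop :=
  ∀ A B : Set X, IsSubcontinuum A → IsSubcontinuum B → A ∪ B = K → IsConnected (A ∩ B)

def IsDendroid (K : Set X) : Prop :=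
  IsSubcontinuum K ∧ IsArcwiseConnected K ∧
    ∀ A, A ⊆ K → IsSubcontinuum A → IsUnicoherent A

def triodModel : Set (ℝ × ℝ) := (Set.Icc (-1) 1 ×ˢ ({0} : Set ℝ)) ∪ (({0} : Set ℝ) ×ˢ Set.Icc 0 1)

lemma triod_top_mem : ((0, 0) : ℝ × ℝ) ∈ triodModel := by
  left; exact ⟨by norm_num, rfl⟩

def IsSimpleTriodWithTop (T : Set X) (x : X) : Prop :=
  ∃ φ : triodModel ≃ₜ T, ((φ ⟨(0, 0), triod_top_mem⟩ : T) : X) = x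

def IsRamificationPoint (K : Set X) (x : X) : Prop :=
  x ∈ K ∧ ∃ T, T ⊆ K ∧ IsSimpleTriodWithTop T x

def IsEndpoint (K : Set X) (x : X) : Prop :=
  x ∈ K ∧ ∀ A, A ⊆ K → IsArc A → x ∈ A → IsEndpointOfArc A x

def IsFan (K : Set X) : Prop :=
  IsDendroid K ∧ ∀ x y, IsRamificationPoint K x → IsRamificationPoint K y → x = y

def IsFanWithTop (K : Set X) (v : X) : Prop := IsFan K ∧ IsRamificationPoint K v

def Legs (K : Set X) (v : X) : Set (Set X) :=
  {A | ∃ e, IsEndpoint K e ∧ A ⊆ K ∧ IsArcFromTo A v e}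

def IsRetractOf (B A : Set X) : Prop :=
  ∃ r : X → X, ContinuousOn r A ∧ Set.MapsTo r A B ∧ Set.EqOn r id B

end Defs

section MetricDefs
variable {X : Type*} [MetricSpace X]

def IsSmoothFan (K : Set X) (v : X) : Prop :=
  IsFanWithTop K v ∧
  ∀ x ∈ K, ∀ xs : ℕ → X, (∀ n, xs n ∈ K) → Tendsto xs atTop (nhds x) →
    ∀ A : Set X, A ⊆ K → IsArcFromTo A v x →
    ∀ As : ℕ → Set X, (∀ n, As n ⊆ K ∧ IsArcFromTo (As n) v (xs n)) →
      Tendsto (fun n => Metric.hausdorffDist (As n) A) atTop (nhds 0)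

def IsLelekFan (K : Set X) (v : X) : Prop :=
  IsSmoothFan K v ∧ K ⊆ closure {x | IsEndpoint K x}

def IsWedge (L : Set X) (v : X) (W : Set X) : Prop :=
  W ⊆ L ∧ IsSubcontinuum W ∧ IsLelekFan W v ∧ IsLelekFan ((L \ W) ∪ {v}) v

end MetricDefs

def coneSetoid (Z : Type*) : Setoid (Z × Set.Icc (0:ℝ) 1) where
  r a b := a = b ∨ ((a.2 : ℝ) = 0 ∧ (b.2 : ℝ) = 0)
  iseqv := by
    refine ⟨fun a => Or.inl rfl, ?_, ?_⟩
    · rintro a b (rfl | h)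
      · exact Or.inl rfl
      · exact Or.inr ⟨h.2, h.1⟩
    · rintro a b c (rfl | h) (rfl | h')
      · exact Or.inl rfl
      · exact Or.inr h'
      · exact Or.inr h
      · exact Or.inr ⟨h.1, h'.2⟩

abbrev CantorFanSpace : Type := Quotient (coneSetoid (ℕ → Bool))

def IsCantorFan {X : Type*} [TopologicalSpace X] (K : Set X) (v : X) : Prop :=
  IsFanWithTop K v ∧ Nonempty (K ≃ₜ CantorFanSpace)

def IsConfluent {X Y : Type*} [TopologicalSpace X] [TopologicalSpace Y] (f : X → Y) : Prop :=
  ∀ Q : Set Y, Q ⊆ Set.range f → IsCompact Q → IsConnected Q →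
    ∀ x ∈ f ⁻¹' Q, f '' connectedComponentIn (f ⁻¹' Q) x = Q

/-- A map is open onto its image if the image of every open set is open in the
subspace `Set.range f`. -/
def IsOpenOntoImage {X Y : Type*} [TopologicalSpace X] [TopologicalSpace Y]
    (f : X → Y) : Prop :=
  ∀ U : Set X, IsOpen U → ∃ V : Set Y, IsOpen V ∧ f '' U = V ∩ Set.range f

/-- The order data of a Lelek fan with top `v`: the set `I x` plays the role of the arc from `v`
to `x`. -/
structure IsLelekOrder {X : Type*} [TopologicalSpace X] (v : X) (I : X → Set X) : Prop where
  self_mem : ∀ x, x ∈ I x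
  root_mem : ∀ x, v ∈ I x
  trans : ∀ {x y}, y ∈ I x → I y ⊆ I x
  antisymm : ∀ {x y}, y ∈ I x → x ∈ I y → x = y
  chain : ∀ {x y z}, y ∈ I x → z ∈ I x → y ∈ I z ∨ z ∈ I y
  unbranched : ∀ {x y z}, x ≠ v → x ∈ I y → x ∈ I z → y ∈ I z ∨ z ∈ I y
  preconnected : ∀ x, IsPreconnected (I x)
  closed_graph : IsClosed {q : X × X | q.2 ∈ I q.1}
  lower : ∀ V : Set X, IsOpen V → IsOpen {x | (I x ∩ V).Nonempty}
  comparable : ∀ K : Set X, IsClosed K → IsPreconnected K → v ∉ K →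
    ∀ x ∈ K, ∀ y ∈ K, x ∈ I y ∨ y ∈ I x
  dense_max : Dense {x | ∀ y, x ∈ I y → y = x}

/-- A continuous function vanishing at `v` and strictly increasing along every `I x`. -/
structure IsHeight {X : Type*} [TopologicalSpace X] (v : X) (I : X → Set X) (p : X → ℝ) :
    Prop where
  cont : Continuous p
  root : p v = 0
  lt : ∀ {x y}, y ∈ I x → y ≠ x → p y < p x

namespace IsLelekOrder

section Basic

variable {X : Type*} [TopologicalSpace X] {v : X} {I : X → Set X}

lemma isClosed_mem (S : IsLelekOrder v I) (x : X) : IsClosed (I x) :=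
  S.closed_graph.preimage (Continuous.prodMk_right x)

lemma isClosed_above (S : IsLelekOrder v I) (y : X) : IsClosed {x | y ∈ I x} :=
  S.closed_graph.preimage (Continuous.prodMk_left y)

lemma eq_root (S : IsLelekOrder v I) {y : X} (h : y ∈ I v) : y = v :=
  (S.antisymm h (S.root_mem y)).symm

end Basic

section Height

variable {X : Type*} [MetricSpace X] [CompactSpace X] {v : X} {I : X → Set X}

lemma bddAbove_image (I : X → Set X) {g : X → ℝ} (hg : Continuous g) (x : X) :
    BddAbove (g '' I x) :=
  (isCompact_range hg).bddAbove.mono (image_subset_range _ _)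

lemma continuous_sSup (S : IsLelekOrder v I) {g : X → ℝ} (hg : Continuous g) :
    Continuous fun x => sSup (g '' I x) := by
  rw [continuous_iff_lower_upperSemicontinuous]
  constructor
  · rw [lowerSemicontinuous_iff_isOpen_preimage]
    intro c
    convert S.lower (g ⁻¹' Ioi c) (isOpen_Ioi.preimage hg) using 1
    ext x
    simp only [mem_preimage, mem_Ioi, mem_ofPred_eq]
    rw [lt_csSup_iff (bddAbove_image I hg x) ⟨_, mem_image_of_mem g (S.self_mem x)⟩]
    simp [Set.Nonempty]
  · rw [upperSemicontinuous_iff_isClosed_preimage]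
    intro c
    have hc : IsClosed (Prod.fst '' ({q : X × X | q.2 ∈ I q.1} ∩ Prod.snd ⁻¹' (g ⁻¹' Ici c))) :=
      isClosedMap_fst_of_compactSpace _
        (S.closed_graph.inter ((isClosed_Ici.preimage hg).preimage continuous_snd))
    convert hc using 1
    ext x
    simp only [mem_preimage, mem_Ici, mem_image, mem_inter_iff, mem_ofPred_eq, Prod.exists,
      exists_and_right, exists_eq_right]
    constructor
    · intro h
      obtain ⟨y, hy, hy'⟩ := (S.isClosed_mem x).isCompact.exists_sSup_image_eq
        ⟨x, S.self_mem x⟩ hg.continuousOn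
      exact ⟨y, hy, hy' ▸ h⟩
    · rintro ⟨y, hy, hc⟩
      exact hc.trans (le_csSup (bddAbove_image I hg x) (mem_image_of_mem g hy))

theorem exists_isHeight (S : IsLelekOrder v I) : ∃ p, IsHeight v I p := by
  obtain ⟨b, hbc, -, hb⟩ := TopologicalSpace.exists_countable_basis X
  have hbn : b.Nonempty := by
    obtain ⟨t, ht, -⟩ := hb.exists_subset_of_mem_open (mem_univ v) isOpen_univ
    exact ⟨t, ht⟩
  obtain ⟨U, rfl⟩ := hbc.exists_eq_range hbn
  let g : ℕ → X → ℝ := fun n x => min 1 (Metric.infDist x (U n)ᶜ)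
  have hg : ∀ n, Continuous (g n) := fun n => continuous_const.min (Metric.continuous_infDist_pt _)
  have hg0 : ∀ n x, 0 ≤ g n x := fun n x => le_min zero_le_one Metric.infDist_nonneg
  have hg1 : ∀ n x, g n x ≤ 1 := fun n x => min_le_left _ _
  let h : ℕ → X → ℝ := fun n x => sSup (g n '' I x)
  have hh : ∀ n, Continuous (h n) := fun n => S.continuous_sSup (hg n)
  have hh0 : ∀ n x, 0 ≤ h n x := fun n x =>
    Real.sSup_nonneg (by rintro _ ⟨y, -, rfl⟩; exact hg0 n y)
  have hh1 : ∀ n x, h n x ≤ 1 := fun n x =>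
    Real.sSup_le (by rintro _ ⟨y, -, rfl⟩; exact hg1 n y) zero_le_one
  have hmono : ∀ n x y, y ∈ I x → h n y ≤ h n x := fun n x y hy =>
    csSup_le_csSup (bddAbove_image I (hg n) x) ⟨_, mem_image_of_mem _ (S.self_mem y)⟩
      (image_mono (S.trans hy))
  have hb1 : ∀ n x, ‖(1 / 2 : ℝ) ^ n * (h n x - h n v)‖ ≤ (1 / 2 : ℝ) ^ n := by
    intro n x
    have h1 := hmono n x v (S.root_mem x)
    rw [Real.norm_of_nonneg (mul_nonneg (by positivity) (sub_nonneg.2 h1))]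
    have h2 := hh0 n v
    have h3 := hh1 n x
    have : (0 : ℝ) ≤ (1 / 2) ^ n := by positivity
    nlinarith
  have hsum : ∀ x, Summable fun n => (1 / 2 : ℝ) ^ n * (h n x - h n v) := fun x =>
    Summable.of_norm_bounded summable_geometric_two (fun n => hb1 n x)
  refine ⟨fun x => ∑' n, (1 / 2 : ℝ) ^ n * (h n x - h n v), ?_, by simp, ?_⟩
  · exact continuous_tsum (fun n => by have := hh n; fun_prop) summable_geometric_two hb1
  · intro x y hy hyx
    have hx : x ∉ I y := fun hx => hyx (S.antisymm hx hy)
    obtain ⟨_, ⟨n, rfl⟩, hxn, hn⟩ := hb.exists_subset_of_mem_open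
      (show x ∈ (I y)ᶜ from hx) (S.isClosed_mem y).isOpen_compl
    have hUo : IsOpen (U n) := hb.isOpen (mem_range_self n)
    have hne : (U n)ᶜ.Nonempty := ⟨y, fun hyn => hn hyn (S.self_mem y)⟩
    refine Summable.tsum_lt_tsum (i := n) (fun k => ?_) ?_ (hsum y) (hsum x)
    · have := hmono k x y hy
      gcongr
    · have h0 : h n y ≤ 0 := by
        refine Real.sSup_le ?_ le_rfl
        rintro _ ⟨z, hz, rfl⟩
        have : z ∈ (U n)ᶜ := fun hz' => hn hz' hz
        simp [g, Metric.infDist_zero_of_mem this]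
      have h1 : 0 < g n x := by
        refine lt_min one_pos ?_
        exact (hUo.isClosed_compl.notMem_iff_infDist_pos hne).1 (fun hx' => hx' hxn)
      have h2 : g n x ≤ h n x :=
        le_csSup (bddAbove_image I (hg n) x) (mem_image_of_mem _ (S.self_mem x))
      have : h n y < h n x := by linarith
      gcongr

end Height
end IsLelekOrder

namespace IsHeight

section Basic

variable {X : Type*} [TopologicalSpace X] {v : X} {I : X → Set X} {p : X → ℝ}

lemma le (hp : IsHeight v I p) {x y : X} (h : y ∈ I x) : p y ≤ p x := by
  rcases eq_or_ne y x with rfl | hne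
  · exact le_rfl
  · exact (hp.lt h hne).le

lemma pos (hp : IsHeight v I p) (S : IsLelekOrder v I) {x : X} (hx : x ≠ v) : 0 < p x :=
  hp.root ▸ hp.lt (S.root_mem x) hx.symm

lemma nonneg (hp : IsHeight v I p) (S : IsLelekOrder v I) (x : X) : 0 ≤ p x :=
  hp.root ▸ hp.le (S.root_mem x)

lemma ne_root (hp : IsHeight v I p) {x : X} (hx : 0 < p x) : x ≠ v := by
  rintro rfl
  exact hx.ne' hp.root

lemma eq_of_cmp (hp : IsHeight v I p) {x y : X} (h : x ∈ I y ∨ y ∈ I x) (he : p x = p y) :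
    x = y := by
  by_contra hne
  rcases h with h | h
  · exact (hp.lt h hne).ne he
  · exact (hp.lt h (Ne.symm hne)).ne he.symm

lemma exists_mem_eq (hp : IsHeight v I p) (S : IsLelekOrder v I) {x : X} {s : ℝ} (h0 : 0 ≤ s)
    (hs : s ≤ p x) : ∃ y ∈ I x, p y = s := by
  have := (S.preconnected x).intermediate_value (S.root_mem x) (S.self_mem x)
    hp.cont.continuousOn
  exact this ⟨hp.root ▸ h0, hs⟩

end Basic

section Compact

variable {X : Type*} [MetricSpace X] [CompactSpace X] {v : X} {I : X → Set X} {p : X → ℝ}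

lemma preconnected_segment (hp : IsHeight v I p) (S : IsLelekOrder v I) {x y : X}
    (h : y ∈ I x) : IsPreconnected {z | z ∈ I x ∧ y ∈ I z} := by
  have : CompactSpace (I x) := isCompact_iff_compactSpace.1 (S.isClosed_mem x).isCompact
  let f : I x → ℝ := fun z => p z
  have hf : Continuous f := hp.cont.comp continuous_subtype_val
  have hinj : Function.Injective f := fun a b hab =>
    Subtype.ext (hp.eq_of_cmp (S.chain a.2 b.2) hab)
  have hpre : IsPreconnected (f ⁻¹' Icc (p y) (p x)) := by
    refine isPreconnected_Icc.preimage_of_isClosedMap hinj hf.isClosedMap ?_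
    intro s hs
    obtain ⟨z, hz, hzs⟩ := hp.exists_mem_eq S ((hp.nonneg S y).trans hs.1) hs.2
    exact ⟨⟨z, hz⟩, hzs⟩
  convert hpre.image _ continuous_subtype_val.continuousOn using 1
  ext z
  constructor
  · rintro ⟨hz, hyz⟩
    exact ⟨⟨z, hz⟩, ⟨hp.le hyz, hp.le hz⟩, rfl⟩
  · rintro ⟨⟨z, hz⟩, ⟨h1, h2⟩, rfl⟩
    refine ⟨hz, ?_⟩
    rcases S.chain h hz with h' | h'
    · exact h'
    · have : z = y := by
        by_contra hne
        exact absurd (hp.lt h' hne) (not_lt.2 h1)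
      exact this ▸ S.self_mem z

lemma eq_of_mem (hp : IsHeight v I p) (S : IsLelekOrder v I) {β : Type*} [TopologicalSpace β]
    [DiscreteTopology β] {c : X → β} (hc : ContinuousOn c {v}ᶜ) {x y : X} (hy : y ≠ v)
    (h : y ∈ I x) : c y = c x := by
  have hpre := hp.preconnected_segment S h
  have hsub : {z | z ∈ I x ∧ y ∈ I z} ⊆ {v}ᶜ := by
    rintro z ⟨-, hz⟩ rfl
    exact hy (S.eq_root hz)
  have := hpre.image c (hc.mono hsub)
  exact this.subsingleton ⟨y, ⟨h, S.self_mem y⟩, rfl⟩ ⟨x, ⟨S.self_mem x, h⟩, rfl⟩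

end Compact
end IsHeight

/-- In a compact Hausdorff space two closed sets which no component meets simultaneously can be
separated by a clopen set. -/
lemma exists_isClopen_separating {T : Type*} [TopologicalSpace T] [CompactSpace T] [T2Space T]
    {U V : Set T} (hU : IsClosed U) (hV : IsClosed V)
    (h : ∀ u ∈ U, ∀ w ∈ V, connectedComponent u ≠ connectedComponent w) :
    ∃ W : Set T, IsClopen W ∧ U ⊆ W ∧ Disjoint W V := by
  let q : T → ConnectedComponents T := ConnectedComponents.mk
  have hq : Continuous q := ConnectedComponents.continuous_coe
  have hUc : IsClosed (q '' U) := (hU.isCompact.image hq).isClosed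
  have hVc : IsClosed (q '' V) := (hV.isCompact.image hq).isClosed
  have hsub : q '' U ⊆ (q '' V)ᶜ := by
    rintro _ ⟨u, hu, rfl⟩ ⟨w, hw, hwu⟩
    exact h u hu w hw (ConnectedComponents.coe_eq_coe.1 hwu).symm
  obtain ⟨W, hW, hUW, hWV⟩ := exists_clopen_of_closed_subset_open hUc hVc.isOpen_compl hsub
  refine ⟨q ⁻¹' W, hW.preimage hq, fun u hu => hUW (mem_image_of_mem q hu), ?_⟩
  rw [Set.disjoint_left]
  exact fun t ht htV => hWV ht (mem_image_of_mem q htV)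

namespace IsHeight

section Separation

variable {X : Type*} [MetricSpace X] [CompactSpace X] {v : X} {I : X → Set X} {p : X → ℝ}

/-- Two closed sets are unrelated when no point of the first one is comparable with a point of the
second one. -/
def Unrelated (I : X → Set X) (U V : Set X) : Prop :=
  IsClosed U ∧ IsClosed V ∧ ∀ u ∈ U, ∀ w ∈ V, ¬ (u ∈ I w ∨ w ∈ I u)

lemma exists_unrelated_extension (hp : IsHeight v I p) (S : IsLelekOrder v I) {ε : ℝ} (hε : 0 < ε)
    {U V : Set X} (hUV : Unrelated I U V) (hU : U ⊆ {x | ε ≤ p x}) (hV : V ⊆ {x | ε ≤ p x}) :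
    ∃ U' V' : Set X, Unrelated I U' V' ∧ U' ∪ V' = {x | ε ≤ p x} ∧ U ⊆ U' ∧ V ⊆ V' := by
  obtain ⟨hUc, hVc, hne⟩ := hUV
  set T : Set X := {x | ε ≤ p x} with hT
  have hTc : IsClosed T := isClosed_le continuous_const hp.cont
  have hvT : v ∉ T := fun h => absurd (hp.root ▸ h : ε ≤ 0) (not_le.2 hε)
  have : CompactSpace T := isCompact_iff_compactSpace.1 hTc.isCompact
  obtain ⟨W, hW, hUW, hWV⟩ := exists_isClopen_separating (T := T)
    (hUc.preimage continuous_subtype_val) (hVc.preimage continuous_subtype_val) (by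
      intro u hu w hw he
      have hK := isPreconnected_connectedComponent (x := u)
      have := S.comparable (Subtype.val '' connectedComponent u)
        ((isClosed_connectedComponent.isCompact.image continuous_subtype_val).isClosed)
        (hK.image _ continuous_subtype_val.continuousOn)
        (by rintro ⟨z, -, hz⟩; exact hvT (hz ▸ z.2))
        u (mem_image_of_mem _ mem_connectedComponent)
        w (mem_image_of_mem _ (he ▸ mem_connectedComponent))
      exact hne u hu w hw this)
  refine ⟨Subtype.val '' W, Subtype.val '' Wᶜ, ⟨?_, ?_, ?_⟩, ?_, ?_, ?_⟩
  · exact (hW.isClosed.isCompact.image continuous_subtype_val).isClosed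
  · exact (hW.compl.isClosed.isCompact.image continuous_subtype_val).isClosed
  · have key : ∀ a b : T, (a : X) ∈ I b → (a ∈ W ↔ b ∈ W) := by
      intro a b hab
      have hpre : IsPreconnected {z : T | (z : X) ∈ I b ∧ (a : X) ∈ I z} := by
        have h1 := hp.preconnected_segment S hab
        rw [← IsInducing.subtypeVal.isPreconnected_image]
        convert h1 using 1
        ext z
        constructor
        · rintro ⟨z, hz, rfl⟩
          exact hz
        · rintro ⟨hz, hz'⟩
          exact ⟨⟨z, le_trans a.2 (hp.le hz')⟩, ⟨hz, hz'⟩, rfl⟩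
      have ha : a ∈ {z : T | (z : X) ∈ I b ∧ (a : X) ∈ I z} := ⟨hab, S.self_mem _⟩
      have hb : b ∈ {z : T | (z : X) ∈ I b ∧ (a : X) ∈ I z} := ⟨S.self_mem _, hab⟩
      constructor
      · intro h
        exact hpre.subset_isClopen hW ⟨a, ha, h⟩ hb
      · intro h
        exact hpre.subset_isClopen hW ⟨b, hb, h⟩ ha
    rintro _ ⟨a, ha, rfl⟩ _ ⟨b, hb, rfl⟩ (h | h)
    · exact hb ((key a b h).1 ha)
    · exact hb ((key b a h).2 ha)
  · rw [← image_union, union_compl_self, image_univ, Subtype.range_val]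
  · exact fun u hu => ⟨⟨u, hU hu⟩, hUW hu, rfl⟩
  · exact fun w hw => ⟨⟨w, hV hw⟩, fun h => Set.disjoint_left.1 hWV h hw, rfl⟩

open Classical in
lemma exists_separation (hp : IsHeight v I p) (S : IsLelekOrder v I) {x : X} (hx : x ≠ v)
    {K : Set X} (hK : IsClosed K) (hvK : v ∉ K) (hxK : ∀ k ∈ K, ¬ (x ∈ I k ∨ k ∈ I x)) :
    ∃ c : X → Bool, ContinuousOn c {v}ᶜ ∧ c x = true ∧ ∀ k ∈ K, c k = false := by
  obtain ⟨ε, hε, hεx, hεK⟩ : ∃ ε : ℝ, 0 < ε ∧ ε ≤ p x ∧ ∀ k ∈ K, ε ≤ p k := by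
    rcases K.eq_empty_or_nonempty with rfl | hne
    · exact ⟨p x, hp.pos S hx, le_rfl, by simp⟩
    · obtain ⟨k, hk, hmin⟩ := hK.isCompact.exists_isMinOn hne hp.cont.continuousOn
      exact ⟨min (p x) (p k), lt_min (hp.pos S hx) (hp.pos S (fun h => hvK (h ▸ hk))),
        min_le_left _ _, fun k' hk' => (min_le_right _ _).trans (hmin hk')⟩
  let e : ℕ → ℝ := fun n => ε / 2 ^ n
  have he : ∀ n, 0 < e n := fun n => by positivity
  have hle : ∀ n, e (n + 1) ≤ e n := fun n => by
    simp only [e]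
    gcongr
    · norm_num
    · simp
  let P : ℕ → Type _ := fun n =>
    {q : Set X × Set X // Unrelated I q.1 q.2 ∧ q.1 ∪ q.2 = {x | e n ≤ p x}}
  have step : ∀ n (q : P n), ∃ q' : P (n + 1), q.1.1 ⊆ q'.1.1 ∧ q.1.2 ⊆ q'.1.2 := by
    rintro n ⟨⟨U, V⟩, hUV, hun⟩
    have hsub : ∀ z ∈ U ∪ V, e (n + 1) ≤ p z := fun z hz =>
      (hle n).trans (hun ▸ hz : z ∈ {x | e n ≤ p x})
    obtain ⟨U', V', h1, h2, h3, h4⟩ := hp.exists_unrelated_extension S (he (n + 1)) hUV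
      (fun z hz => hsub z (Or.inl hz)) (fun z hz => hsub z (Or.inr hz))
    exact ⟨⟨(U', V'), h1, h2⟩, h3, h4⟩
  choose nxt hn1 hn2 using step
  obtain ⟨U₀, V₀, h1, h2, h3, h4⟩ := hp.exists_unrelated_extension S (he 0) (U := {x}) (V := K)
    ⟨isClosed_singleton, hK, by rintro _ rfl k hk; exact hxK k hk⟩
    (by rintro _ rfl; simpa [e] using hεx) (fun k hk => by simpa [e] using hεK k hk)
  let Q : ∀ n, P n := fun n => Nat.rec ⟨(U₀, V₀), h1, h2⟩ (fun n q => nxt n q) n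
  have hm1 : Monotone fun n => (Q n).1.1 := monotone_nat_of_le_succ fun n => hn1 n (Q n)
  have hm2 : Monotone fun n => (Q n).1.2 := monotone_nat_of_le_succ fun n => hn2 n (Q n)
  have hdisj : ∀ m n z, z ∈ (Q m).1.1 → z ∉ (Q n).1.2 := by
    intro m n z h h'
    exact (Q (max m n)).2.1.2.2 z (hm1 (le_max_left m n) h) z (hm2 (le_max_right m n) h')
      (Or.inl (S.self_mem z))
  have hlev : ∀ z, z ≠ v → ∃ n, e n < p z := by
    intro z hz
    have ht : Tendsto e atTop (𝓝 0) := by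
      have := tendsto_pow_atTop_nhds_zero_of_lt_one (r := (1 / 2 : ℝ)) (by norm_num) (by norm_num)
      have := this.const_mul ε
      simp only [mul_zero] at this
      refine this.congr fun n => ?_
      simp [e, div_eq_mul_inv]
    exact (ht.eventually (gt_mem_nhds (hp.pos S hz))).exists
  refine ⟨fun z => decide (∃ n, z ∈ (Q n).1.1), ?_, ?_, ?_⟩
  · intro z hz
    refine ContinuousAt.continuousWithinAt ?_
    obtain ⟨n, hn⟩ := hlev z hz
    have hopen : IsOpen {y | e n < p y} := isOpen_lt continuous_const hp.cont
    have hcov : ∀ y, e n < p y → y ∈ (Q n).1.1 ∨ y ∈ (Q n).1.2 := fun y hy => by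
      have : y ∈ (Q n).1.1 ∪ (Q n).1.2 := by rw [(Q n).2.2]; exact hy.le
      exact this
    rcases hcov z hn with hz1 | hz2
    · have : ∀ᶠ y in 𝓝 z, y ∈ (Q n).1.1 := by
        filter_upwards [hopen.mem_nhds hn,
          (Q n).2.1.2.1.isOpen_compl.mem_nhds (hdisj n n z hz1)] with y hy hy'
        exact (hcov y hy).resolve_right hy'
      refine (continuousAt_const (y := true)).congr ?_
      filter_upwards [this] with y hy
      exact (decide_eq_true ⟨n, hy⟩).symm
    · have hz1 : z ∉ (Q n).1.1 := fun h => hdisj n n z h hz2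
      have : ∀ᶠ y in 𝓝 z, y ∈ (Q n).1.2 := by
        filter_upwards [hopen.mem_nhds hn, (Q n).2.1.1.isOpen_compl.mem_nhds hz1] with y hy hy'
        exact (hcov y hy).resolve_left hy'
      refine (continuousAt_const (y := false)).congr ?_
      filter_upwards [this] with y hy
      exact (decide_eq_false (by rintro ⟨m, hm⟩; exact hdisj m n y hm hy)).symm
  · exact decide_eq_true ⟨0, h3 rfl⟩
  · intro k hk
    exact decide_eq_false (by rintro ⟨m, hm⟩; exact hdisj m 0 k hm (h4 hk))

/-- Countably many locally constant functions on the complement of the top separate the legs. -/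
theorem exists_separating_seq (hp : IsHeight v I p) (S : IsLelekOrder v I) :
    ∃ c : ℕ → X → Bool, (∀ n, ContinuousOn (c n) {v}ᶜ) ∧
      ∀ x y, x ≠ v → y ≠ v → (∀ n, c n x = c n y) → x ∈ I y ∨ y ∈ I x := by
  let C := {c : X → Bool // ContinuousOn c {v}ᶜ}
  let O : C → Set (X × X) := fun c => {q | (q.1 ≠ v ∧ c.1 q.1 = true) ∧ q.2 ≠ v ∧ c.1 q.2 = false}
  have hopen : ∀ (c : C) (b : Bool), IsOpen {x | x ≠ v ∧ c.1 x = b} := fun c b =>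
    c.2.isOpen_inter_preimage isOpen_compl_singleton (isOpen_discrete {b})
  have hO : ∀ c, IsOpen (O c) := fun c =>
    ((hopen c true).preimage continuous_fst).inter ((hopen c false).preimage continuous_snd)
  obtain ⟨T, hT, hTU⟩ := TopologicalSpace.isOpen_iUnion_countable O hO
  have hne : (T ∪ {⟨fun _ => true, continuousOn_const⟩}).Nonempty := ⟨_, Or.inr rfl⟩
  obtain ⟨c, hc⟩ := (hT.union (countable_singleton _)).exists_eq_range hne
  refine ⟨fun n => (c n).1, fun n => (c n).2, fun x y hx hy hxy => ?_⟩
  by_contra hcon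
  obtain ⟨d, hd, hdx, hdy⟩ := hp.exists_separation S hx isClosed_singleton
    (K := {y}) (by simpa using hy.symm) (by rintro _ rfl; exact hcon)
  have hmem : (x, y) ∈ ⋃ c, O c :=
    mem_iUnion.2 ⟨⟨d, hd⟩, ⟨hx, hdx⟩, hy, hdy y rfl⟩
  rw [← hTU] at hmem
  obtain ⟨d', hd', hxy'⟩ := mem_iUnion₂.1 hmem
  obtain ⟨n, rfl⟩ : d' ∈ range c := hc ▸ Or.inl hd'
  exact absurd (hxy'.1.2.symm.trans ((hxy n).trans hxy'.2.2)) (by decide)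

end Separation
end IsHeight

namespace IsHeight

lemma exists_lt_of_lt_sSup {X : Type*} {p : X → ℝ} {A : Set X} {t : ℝ} (ht : 0 ≤ t)
    (h : t < sSup (p '' A)) :
    ∃ x ∈ A, t < p x := by
  by_contra! hcon
  exact absurd h (not_lt.2 (Real.sSup_le (by rintro _ ⟨x, hx, rfl⟩; exact hcon x hx) ht))

section General

variable {X Y : Type*} [TopologicalSpace X] [TopologicalSpace Y] {v : X} {I : X → Set X}
  {p : X → ℝ} {w : Y} {q : Y → ℝ}

lemma sSup_nonneg (hp : IsHeight v I p) (S : IsLelekOrder v I) (A : Set X) : 0 ≤ sSup (p '' A) :=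
  Real.sSup_nonneg (by rintro _ ⟨x, -, rfl⟩; exact hp.nonneg S x)

/-- Two labelled clopen partitions whose corresponding pieces have, up to the weights `exp ∘ σ` and
`exp ∘ τ`, the same maximal heights. -/
structure Matched (v : X) (w : Y) (p : X → ℝ) (q : Y → ℝ) (a : X → ℕ) (b : Y → ℕ) (σ τ : ℕ → ℝ) :
    Prop where
  left : ContinuousOn a {v}ᶜ
  right : ContinuousOn b {w}ᶜ
  eq : ∀ i, Real.exp (σ i) * sSup (p '' {x | x ≠ v ∧ a x = i}) =
    Real.exp (τ i) * sSup (q '' {y | y ≠ w ∧ b y = i})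

lemma Matched.symm {a : X → ℕ} {b : Y → ℕ} {σ τ : ℕ → ℝ} (h : Matched v w p q a b σ τ) :
    Matched w v q p b a τ σ :=
  ⟨h.right, h.left, fun i => (h.eq i).symm⟩

lemma continuousOn_refine {a : X → ℕ} {c : X → Bool} (ha : ContinuousOn a {v}ᶜ)
    (hc : ContinuousOn c {v}ᶜ) : ContinuousOn (fun x => 2 * a x + (c x).toNat) {v}ᶜ :=
  (continuous_of_discreteTopology (f := fun r : ℕ × Bool => 2 * r.1 + r.2.toNat)).comp_continuousOn
    (ha.prodMk hc)

end General

section Split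

variable {X : Type*} [MetricSpace X] [CompactSpace X] {v : X} {I : X → Set X} {p : X → ℝ}

lemma le_sSup (hp : IsHeight v I p) {A : Set X} {x : X} (hx : x ∈ A) : p x ≤ sSup (p '' A) :=
  le_csSup ((isCompact_range hp.cont).bddAbove.mono (image_subset_range _ _))
    (mem_image_of_mem p hx)

lemma sSup_mono (hp : IsHeight v I p) (S : IsLelekOrder v I) {A B : Set X} (h : A ⊆ B) :
    sSup (p '' A) ≤ sSup (p '' B) :=
  Real.sSup_le (by rintro _ ⟨x, hx, rfl⟩; exact hp.le_sSup (h hx)) (hp.sSup_nonneg S B)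

/-- The smaller of two prescribed suprema can be realized approximately on a clopen piece which
does not affect the total supremum. -/
lemma exists_split_of_le (hp : IsHeight v I p) (S : IsLelekOrder v I) {A : Set X} (hA : IsOpen A)
    (hvA : v ∉ A) (hsat : ∀ x ∈ A, ∀ y ∈ I x, y ≠ v → y ∈ A) {u ε : ℝ} (hu : 0 ≤ u)
    (hu' : u ≤ sSup (p '' A)) (hε : 0 < ε) :
    ∃ c : X → Bool, ContinuousOn c {v}ᶜ ∧
      sSup (p '' {x | x ∈ A ∧ c x = false}) = sSup (p '' A) ∧
      ∃ δ : ℝ, |δ| ≤ ε ∧ Real.exp δ * sSup (p '' {x | x ∈ A ∧ c x = true}) = u := by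
  rcases hu.eq_or_lt with rfl | hpos
  · exact ⟨fun _ => false, continuousOn_const, by simp, 0, by simpa using hε.le, by simp⟩
  have hlt : Real.exp (-ε) * u < u := by
    have : Real.exp (-ε) < 1 := by
      rw [← Real.exp_zero]
      exact Real.exp_lt_exp.2 (by linarith)
    nlinarith
  have hlow : 0 < Real.exp (-ε) * u := by positivity
  obtain ⟨t, ht1, ht2⟩ := exists_between hlt
  obtain ⟨x, hxA, hx⟩ := exists_lt_of_lt_sSup (by linarith) (ht2.trans_le hu')
  obtain ⟨y, hy, hyt⟩ := hp.exists_mem_eq S (by linarith) hx.le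
  have hyA : y ∈ A := hsat x hxA y hy (hp.ne_root (by linarith))
  obtain ⟨e, ⟨⟨⟨heA, he1⟩, he2⟩, hmax⟩⟩ := S.dense_max.inter_open_nonempty
    ((A ∩ p ⁻¹' Ioi (Real.exp (-ε) * u)) ∩ p ⁻¹' Iio u)
    ((hA.inter (isOpen_Ioi.preimage hp.cont)).inter (isOpen_Iio.preimage hp.cont))
    ⟨y, ⟨hyA, by simpa [hyt] using ht1⟩, by simpa [hyt] using ht2⟩
  obtain ⟨u', hu1, hu2⟩ := exists_between (show p e < u from he2)
  have hev : e ≠ v := fun h => hvA (h ▸ heA)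
  obtain ⟨c, hc, hce, hcK⟩ := hp.exists_separation S hev (K := {x | u' ≤ p x})
    (isClosed_le continuous_const hp.cont)
    (fun h => by
      have h' : u' ≤ p v := h
      rw [hp.root] at h'
      linarith [hp.nonneg S e])
    (by
      rintro k hk (h | h)
      · have := hmax k h
        subst this
        exact absurd hk (not_le.2 hu1)
      · exact absurd ((show u' ≤ p k from hk).trans (hp.le h)) (not_le.2 hu1))
  have hle : sSup (p '' {x | x ∈ A ∧ c x = true}) ≤ u' := by
    refine Real.sSup_le ?_ (by linarith [hp.nonneg S e])
    rintro _ ⟨z, ⟨-, hz⟩, rfl⟩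
    by_contra hcon
    exact absurd (hz.symm.trans (hcK z (not_le.1 hcon).le)) (by decide)
  have hge : p e ≤ sSup (p '' {x | x ∈ A ∧ c x = true}) := hp.le_sSup ⟨heA, hce⟩
  have hepos : 0 < p e := hp.pos S hev
  set m := sSup (p '' {x | x ∈ A ∧ c x = true}) with hm
  have hmpos : 0 < m := hepos.trans_le hge
  refine ⟨c, hc, ?_, Real.log (u / m), ?_, ?_⟩
  · refine le_antisymm (hp.sSup_mono S fun z hz => hz.1) ?_
    by_contra! hcon
    obtain ⟨z, hz, hzl⟩ := exists_lt_of_lt_sSup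
      (le_max_of_le_left (hp.sSup_nonneg S {x | x ∈ A ∧ c x = false}))
      (max_lt hcon ((hle.trans_lt hu2).trans_le hu'))
    rw [max_lt_iff] at hzl
    cases hcz : c z
    · exact absurd (hp.le_sSup (A := {x | x ∈ A ∧ c x = false}) ⟨hz, hcz⟩) (not_le.2 hzl.1)
    · exact absurd (hp.le_sSup (A := {x | x ∈ A ∧ c x = true}) ⟨hz, hcz⟩) (not_le.2 hzl.2)
  · rw [abs_of_nonneg (Real.log_nonneg ((one_le_div hmpos).2 (hle.trans hu2.le)))]
    rw [Real.log_le_iff_le_exp (by positivity), div_le_iff₀ hmpos]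
    have h1 : Real.exp (-ε) * u < m := (show Real.exp (-ε) * u < p e from he1).trans_le hge
    rw [Real.exp_neg, inv_mul_lt_iff₀ (Real.exp_pos _)] at h1
    exact h1.le
  · rw [Real.exp_log (by positivity), div_mul_cancel₀ _ hmpos.ne']

lemma exists_split (hp : IsHeight v I p) (S : IsLelekOrder v I) {A : Set X} (hA : IsOpen A)
    (hvA : v ∉ A) (hsat : ∀ x ∈ A, ∀ y ∈ I x, y ≠ v → y ∈ A) {u : Bool → ℝ} {ε : ℝ}
    (hu : ∀ i, 0 ≤ u i) (hu' : max (u false) (u true) = sSup (p '' A)) (hε : 0 < ε) :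
    ∃ (c : X → Bool) (δ : Bool → ℝ), ContinuousOn c {v}ᶜ ∧ (∀ i, |δ i| ≤ ε) ∧
      ∀ i, Real.exp (δ i) * sSup (p '' {x | x ∈ A ∧ c x = i}) = u i := by
  rcases le_total (u true) (u false) with h | h
  · rw [max_eq_left h] at hu'
    obtain ⟨c, hc, h1, δ, hδ, h2⟩ := hp.exists_split_of_le S hA hvA hsat (hu true) (hu' ▸ h) hε
    refine ⟨c, fun i => cond i δ 0, hc, ?_, ?_⟩
    · rintro (_ | _)
      · simpa using hε.le
      · exact hδ
    · rintro (_ | _)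
      · simp [h1, hu']
      · exact h2
  · rw [max_eq_right h] at hu'
    obtain ⟨c, hc, h1, δ, hδ, h2⟩ := hp.exists_split_of_le S hA hvA hsat (hu false) (hu' ▸ h) hε
    refine ⟨fun x => !c x, fun i => cond i 0 δ,
      (continuous_of_discreteTopology (f := Bool.not)).comp_continuousOn hc, ?_, ?_⟩
    · rintro (_ | _)
      · exact hδ
      · simpa using hε.le
    · rintro (_ | _)
      · simpa using h2
      · simp [h1, hu']

end Split

section Matching

variable {X Y : Type*} [MetricSpace X] [CompactSpace X] [MetricSpace Y] [CompactSpace Y]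
  {v : X} {I : X → Set X} {p : X → ℝ} {w : Y} {J : Y → Set Y} {q : Y → ℝ}

lemma refine_eq_iff {m i : ℕ} {s t : Bool} : 2 * m + s.toNat = 2 * i + t.toNat ↔ m = i ∧ s = t := by
  cases s <;> cases t <;> simp <;> omega

lemma exists_two_mul_add (j : ℕ) : ∃ (i : ℕ) (t : Bool), j = 2 * i + t.toNat := by
  rcases Nat.even_or_odd' j with ⟨i, rfl | rfl⟩
  · exact ⟨i, false, by simp⟩
  · exact ⟨i, true, by simp⟩

lemma refine_div_two (i : ℕ) (t : Bool) : (2 * i + t.toNat) / 2 = i := by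
  cases t
  · simp
  · simp; omega

lemma Matched.exists_refine (hp : IsHeight v I p) (S : IsLelekOrder v I) (hq : IsHeight w J q)
    (T : IsLelekOrder w J) {a : X → ℕ} {b : Y → ℕ} {σ τ : ℕ → ℝ} (h : Matched v w p q a b σ τ)
    {d : Y → Bool} (hd : ContinuousOn d {w}ᶜ) {ε : ℝ} (hε : 0 < ε) :
    ∃ (c : X → Bool) (σ' : ℕ → ℝ), (∀ j, |σ' j - σ (j / 2)| ≤ ε) ∧
      Matched v w p q (fun x => 2 * a x + (c x).toNat) (fun y => 2 * b y + (d y).toNat) σ'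
        (fun j => τ (j / 2)) := by
  have hopen : ∀ i, IsOpen {x | x ≠ v ∧ a x = i} := fun i =>
    h.left.isOpen_inter_preimage isOpen_compl_singleton (isOpen_discrete {i})
  have hsplit : ∀ i, ∃ (c : X → Bool) (δ : Bool → ℝ), ContinuousOn c {v}ᶜ ∧ (∀ t, |δ t| ≤ ε) ∧
      ∀ t, Real.exp (δ t) * sSup (p '' {x | x ∈ {x | x ≠ v ∧ a x = i} ∧ c x = t}) =
        Real.exp (τ i - σ i) * sSup (q '' {y | (y ≠ w ∧ b y = i) ∧ d y = t}) := by
    intro i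
    refine hp.exists_split S (hopen i) (fun hv => hv.1 rfl) ?_
      (fun t => mul_nonneg (Real.exp_pos _).le (hq.sSup_nonneg T _)) ?_ hε
    · rintro x ⟨hx, rfl⟩ y hy hyv
      exact ⟨hyv, hp.eq_of_mem S h.left hyv hy⟩
    · have h1 : sSup (p '' {x | x ≠ v ∧ a x = i}) =
          Real.exp (τ i - σ i) * sSup (q '' {y | y ≠ w ∧ b y = i}) := by
        rw [Real.exp_sub, div_mul_eq_mul_div, ← h.eq i, mul_div_cancel_left₀ _ (Real.exp_pos _).ne']
      rw [h1, ← mul_max_of_nonneg _ _ (Real.exp_pos _).le]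
      congr 1
      refine le_antisymm (max_le (hq.sSup_mono T fun z hz => hz.1)
        (hq.sSup_mono T fun z hz => hz.1)) ?_
      refine Real.sSup_le ?_ (le_max_of_le_left (hq.sSup_nonneg T _))
      rintro _ ⟨z, hz, rfl⟩
      cases hdz : d z
      · exact (hq.le_sSup (A := {y | (y ≠ w ∧ b y = i) ∧ d y = false}) ⟨hz, hdz⟩).trans
          (le_max_left _ _)
      · exact (hq.le_sSup (A := {y | (y ≠ w ∧ b y = i) ∧ d y = true}) ⟨hz, hdz⟩).trans
          (le_max_right _ _)
  choose c δ hc hδ hcδ using hsplit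
  have hcc : ContinuousOn (fun x => c (a x) x) {v}ᶜ := by
    intro x hx
    refine ContinuousWithinAt.congr_of_eventuallyEq (hc (a x) x hx) ?_ rfl
    have := h.left x hx (show ({a x} : Set ℕ) ∈ 𝓝 (a x) from by simp)
    filter_upwards [this] with z hz
    rw [show a z = a x from hz]
  refine ⟨fun x => c (a x) x, fun j => σ (j / 2) + δ (j / 2) (decide (j % 2 = 1)), fun j => ?_,
    continuousOn_refine h.left hcc, continuousOn_refine h.right hd, fun j => ?_⟩
  · simpa using hδ _ _
  · obtain ⟨i, t, rfl⟩ := exists_two_mul_add j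
    have ht : decide ((2 * i + t.toNat) % 2 = 1) = t := by
      cases t <;> simp [Nat.add_mod]
    simp only [refine_div_two, ht, refine_eq_iff]
    have hset : {x | x ≠ v ∧ a x = i ∧ c (a x) x = t} =
        {x | x ∈ {x | x ≠ v ∧ a x = i} ∧ c i x = t} := by
      ext x
      constructor
      · rintro ⟨h1, rfl, h2⟩
        exact ⟨⟨h1, rfl⟩, h2⟩
      · rintro ⟨⟨h1, rfl⟩, h2⟩
        exact ⟨h1, rfl, h2⟩
    have hset' : {y | y ≠ w ∧ b y = i ∧ d y = t} = {y | (y ≠ w ∧ b y = i) ∧ d y = t} := by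
      ext y
      exact and_assoc.symm
    rw [hset, hset', Real.exp_add, mul_assoc, hcδ, ← mul_assoc, ← Real.exp_add]
    congr 2
    ring

end Matching
end IsHeight

namespace IsHeight

section Limit

variable {X : Type*} [MetricSpace X] [CompactSpace X] {v : X} {I : X → Set X} {p : X → ℝ}

/-- Rescaling a height by a convergent sequence of locally constant weights gives a height. -/
lemma exists_limit (hp : IsHeight v I p) (S : IsLelekOrder v I) {a : ℕ → X → ℕ} {σ : ℕ → ℕ → ℝ}
    {B : ℝ} (ha : ∀ n, ContinuousOn (a n) {v}ᶜ) (ha' : ∀ n x, a (n + 1) x / 2 / 2 = a n x)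
    (hB : ∀ j, |σ 0 j| ≤ B) (hσ : ∀ n j, |σ (n + 1) j - σ n (j / 2 / 2)| ≤ 1 / 2 / 2 ^ n) :
    ∃ P : X → ℝ, IsHeight v I P ∧
      ∀ n x, P x ≤ Real.exp (1 / 2 ^ n) * (Real.exp (σ n (a n x)) * p x) ∧
        Real.exp (σ n (a n x)) * p x ≤ Real.exp (1 / 2 ^ n) * P x := by
  have hd : ∀ x n, dist (σ n (a n x)) (σ (n + 1) (a (n + 1) x)) ≤ 1 / 2 / 2 ^ n := by
    intro x n
    rw [dist_comm, Real.dist_eq, ← ha' n x]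
    exact hσ n _
  have hlim : ∀ x, ∃ l, Tendsto (fun n => σ n (a n x)) atTop (𝓝 l) := fun x =>
    cauchySeq_tendsto_of_complete (cauchySeq_of_le_geometric_two (hd x))
  choose s hs using hlim
  have hdist : ∀ n x, |σ n (a n x) - s x| ≤ 1 / 2 ^ n := fun n x => by
    rw [← Real.dist_eq]
    exact dist_le_of_le_geometric_two_of_tendsto (hd x) (hs x) n
  have hsc : ContinuousOn s {v}ᶜ := by
    have hu : TendstoUniformlyOn (fun n x => σ n (a n x)) s atTop {v}ᶜ := by
      rw [Metric.tendstoUniformlyOn_iff]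
      intro ε hε
      have ht : Tendsto (fun n : ℕ => (1 / 2 : ℝ) ^ n) atTop (𝓝 0) :=
        tendsto_pow_atTop_nhds_zero_of_lt_one (by norm_num) (by norm_num)
      filter_upwards [ht.eventually (gt_mem_nhds hε)] with n hn x _
      rw [dist_comm, Real.dist_eq]
      refine (hdist n x).trans_lt ?_
      rwa [← one_div_pow]
    exact hu.continuousOn (Eventually.of_forall fun n =>
      (continuous_of_discreteTopology (f := σ n)).comp_continuousOn (ha n)).frequently
  have hleg : ∀ x y, y ≠ v → y ∈ I x → s y = s x := by
    intro x y hy hyx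
    refine tendsto_nhds_unique (hs y) ((hs x).congr fun n => ?_)
    rw [hp.eq_of_mem S (ha n) hy hyx]
  have hsB : ∀ x, s x ≤ B + 1 := by
    intro x
    have h1 := abs_le.1 (hdist 0 x)
    have h2 := abs_le.1 (hB (a 0 x))
    norm_num at h1
    linarith [h1.1, h2.2]
  refine ⟨fun x => Real.exp (s x) * p x, ⟨?_, by simp [hp.root], ?_⟩, ?_⟩
  · rw [continuous_iff_continuousAt]
    intro x
    by_cases hx : x = v
    · subst hx
      have h0 : Tendsto (fun y => Real.exp (B + 1) * p y) (𝓝 x) (𝓝 0) := by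
        have := (hp.cont.tendsto x).const_mul (Real.exp (B + 1))
        rwa [hp.root, mul_zero] at this
      have : Tendsto (fun y => Real.exp (s y) * p y) (𝓝 x) (𝓝 0) := by
        refine squeeze_zero (fun y => mul_nonneg (Real.exp_pos _).le (hp.nonneg S y))
          (fun y => ?_) h0
        exact mul_le_mul_of_nonneg_right (Real.exp_le_exp.2 (hsB y)) (hp.nonneg S y)
      simpa [ContinuousAt, hp.root] using this
    · have := hsc.continuousAt (isOpen_compl_singleton.mem_nhds hx)
      exact (Real.continuous_exp.continuousAt.comp this).mul hp.cont.continuousAt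
  · intro x y hy hyx
    by_cases hyv : y = v
    · subst hyv
      rw [hp.root, mul_zero]
      exact mul_pos (Real.exp_pos _) (hp.pos S hyx.symm)
    · rw [hleg x y hyv hy]
      exact mul_lt_mul_of_pos_left (hp.lt hy hyx) (Real.exp_pos _)
  · intro n x
    have h1 := abs_le.1 (hdist n x)
    simp only [← mul_assoc, ← Real.exp_add]
    exact ⟨mul_le_mul_of_nonneg_right (Real.exp_le_exp.2 (by linarith [h1.1])) (hp.nonneg S x),
      mul_le_mul_of_nonneg_right (Real.exp_le_exp.2 (by linarith [h1.2])) (hp.nonneg S x)⟩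

end Limit

section Uniqueness

variable {X Y : Type*} [MetricSpace X] [CompactSpace X] [MetricSpace Y] [CompactSpace Y]
  {v : X} {I : X → Set X} {p : X → ℝ} {w : Y} {J : Y → Set Y} {q : Y → ℝ}

lemma exists_partner {P : X → ℝ} {Q : Y → ℝ} (hp : IsHeight v I p) (S : IsLelekOrder v I)
    (hq : IsHeight w J q) (T : IsLelekOrder w J) (hP : IsHeight v I P) (hQ : IsHeight w J Q)
    {a : ℕ → X → ℕ} {b : ℕ → Y → ℕ} {σ τ : ℕ → ℕ → ℝ}
    (hm : ∀ n, Matched v w p q (a n) (b n) (σ n) (τ n))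
    (ha : ∀ n x, a (n + 1) x / 2 / 2 = a n x) (hb : ∀ n y, b (n + 1) y / 2 / 2 = b n y)
    (hPp : ∀ n x, P x ≤ Real.exp (1 / 2 ^ n) * (Real.exp (σ n (a n x)) * p x))
    (hQq : ∀ n y, Real.exp (τ n (b n y)) * q y ≤ Real.exp (1 / 2 ^ n) * Q y)
    {x : X} (hx : x ≠ v) : ∃ y, y ≠ w ∧ (∀ n, a n x = b n y) ∧ P x = Q y := by
  have hPx := hP.pos S hx
  let G : ℕ → Set Y := fun n =>
    {y | Real.exp (-(3 / 2 ^ n)) * P x ≤ Q y} \ ({w}ᶜ ∩ b n ⁻¹' {a n x}ᶜ)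
  have hGw : ∀ n y, y ∈ G n → y ≠ w := fun n y hy =>
    hQ.ne_root ((mul_pos (Real.exp_pos _) hPx).trans_le hy.1)
  have hGb : ∀ n y, y ∈ G n → b n y = a n x := fun n y hy => by
    by_contra hne
    exact hy.2 ⟨hGw n y hy, hne⟩
  have hGc : ∀ n, IsClosed (G n) := fun n =>
    (isClosed_le continuous_const hQ.cont).sdiff
      ((hm n).right.isOpen_inter_preimage isOpen_compl_singleton (isOpen_discrete _))
  have hGne : ∀ n, (G n).Nonempty := by
    intro n
    have hpx := hp.pos S hx
    have h1 : Real.exp (σ n (a n x)) * p x ≤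
        Real.exp (τ n (a n x)) * sSup (q '' {y | y ≠ w ∧ b n y = a n x}) := by
      rw [← (hm n).eq]
      exact mul_le_mul_of_nonneg_left (hp.le_sSup (A := {z | z ≠ v ∧ a n z = a n x}) ⟨hx, rfl⟩)
        (Real.exp_pos _).le
    have h2 : Real.exp (-(1 / 2 ^ n)) * P x ≤ Real.exp (σ n (a n x)) * p x := by
      rw [Real.exp_neg, inv_mul_le_iff₀ (Real.exp_pos _)]
      exact hPp n x
    have h3 : Real.exp (-(2 / 2 ^ n)) * P x < Real.exp (-(1 / 2 ^ n)) * P x := by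
      refine mul_lt_mul_of_pos_right (Real.exp_lt_exp.2 ?_) hPx
      have : (0 : ℝ) < 1 / 2 ^ n := by positivity
      have h' : (2 : ℝ) / 2 ^ n = 2 * (1 / 2 ^ n) := by ring
      rw [h']
      linarith
    have h4 := (h3.trans_le h2).trans_le h1
    rw [← div_lt_iff₀' (Real.exp_pos _)] at h4
    obtain ⟨y, ⟨hyw, hyb⟩, hy⟩ := exists_lt_of_lt_sSup (by positivity) h4
    rw [div_lt_iff₀' (Real.exp_pos _), ← hyb] at hy
    refine ⟨y, show Real.exp (-(3 / 2 ^ n)) * P x ≤ Q y from ?_, fun h => h.2 hyb⟩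
    have h5 := hy.le.trans (hQq n y)
    rw [← inv_mul_le_iff₀ (Real.exp_pos _), ← Real.exp_neg, ← mul_assoc, ← Real.exp_add] at h5
    have h6 : -(1 / 2 ^ n : ℝ) + -(2 / 2 ^ n) = -(3 / 2 ^ n) := by ring
    rwa [h6] at h5
  have hGanti : ∀ n, G (n + 1) ⊆ G n := by
    intro n y hy
    have hy' : Real.exp (-(3 / 2 ^ (n + 1))) * P x ≤ Q y := hy.1
    refine ⟨show Real.exp (-(3 / 2 ^ n)) * P x ≤ Q y from le_trans ?_ hy', fun h => h.2 ?_⟩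
    · refine mul_le_mul_of_nonneg_right (Real.exp_le_exp.2 (neg_le_neg ?_)) hPx.le
      gcongr
      · norm_num
      · simp
    · rw [mem_singleton_iff, ← hb, hGb _ _ hy, ha]
  obtain ⟨y, hy⟩ := IsCompact.nonempty_iInter_of_sequence_nonempty_isCompact_isClosed G hGanti
    hGne (hGc 0).isCompact hGc
  rw [mem_iInter] at hy
  have hlim : Tendsto (fun n : ℕ => Real.exp (-(3 / 2 ^ n)) * P x) atTop (𝓝 (P x)) := by
    have h1 : Tendsto (fun n : ℕ => -(3 * (1 / 2 : ℝ) ^ n)) atTop (𝓝 0) := by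
      simpa using ((tendsto_pow_atTop_nhds_zero_of_lt_one (r := (1 / 2 : ℝ)) (by norm_num)
        (by norm_num)).const_mul 3).neg
    have h2 := ((Real.continuous_exp.tendsto 0).comp h1).mul_const (P x)
    rw [Real.exp_zero, one_mul] at h2
    refine h2.congr fun n => ?_
    simp [div_eq_mul_inv]
  have hle : P x ≤ Q y := le_of_tendsto' hlim fun n => (hy n).1
  obtain ⟨z, hz, hzP⟩ := hQ.exists_mem_eq T hPx.le hle
  have hzw : z ≠ w := hQ.ne_root (hzP ▸ hPx)
  refine ⟨z, hzw, fun n => ?_, hzP.symm⟩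
  rw [hq.eq_of_mem T (hm n).right hzw hz, hGb n y (hy n)]

end Uniqueness
end IsHeight

namespace IsHeight

section Stages

variable {X Y : Type*} [MetricSpace X] [CompactSpace X] [MetricSpace Y] [CompactSpace Y]
  {v : X} {I : X → Set X} {p : X → ℝ} {w : Y} {J : Y → Set Y} {q : Y → ℝ}

lemma Matched.exists_refine_both (hp : IsHeight v I p) (S : IsLelekOrder v I)
    (hq : IsHeight w J q) (T : IsLelekOrder w J) {a : X → ℕ} {b : Y → ℕ} {σ τ : ℕ → ℝ}
    (h : Matched v w p q a b σ τ) {c : X → Bool} {d : Y → Bool} (hc : ContinuousOn c {v}ᶜ)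
    (hd : ContinuousOn d {w}ᶜ) {ε : ℝ} (hε : 0 < ε) :
    ∃ (a' : X → ℕ) (b' : Y → ℕ) (σ' τ' : ℕ → ℝ), Matched v w p q a' b' σ' τ' ∧
      (∀ x, a' x / 2 / 2 = a x) ∧ (∀ y, b' y / 2 / 2 = b y) ∧
      (∀ j, |σ' j - σ (j / 2 / 2)| ≤ ε) ∧ (∀ j, |τ' j - τ (j / 2 / 2)| ≤ ε) ∧
      (∀ x x', a' x = a' x' → c x = c x') ∧ ∀ y y', b' y = b' y' → d y = d y' := by
  obtain ⟨c₁, σ₁, hσ, h₁⟩ := h.exists_refine hp S hq T hd hε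
  obtain ⟨d₁, τ₁, hτ, h₂⟩ := h₁.symm.exists_refine hq T hp S hc hε
  refine ⟨_, _, _, _, h₂.symm, fun x => ?_, fun y => ?_, fun j => hσ _, hτ, fun x x' hx => ?_,
    fun y y' hy => ?_⟩
  · simp only [refine_div_two]
  · simp only [refine_div_two]
  · exact (refine_eq_iff.1 hx).2
  · exact (refine_eq_iff.1 (refine_eq_iff.1 hy).1).2

lemma exists_matched_seq (hp : IsHeight v I p) (S : IsLelekOrder v I) (hq : IsHeight w J q)
    (T : IsLelekOrder w J) (hX : ∃ x, x ≠ v) (hY : ∃ y, y ≠ w) {c : ℕ → X → Bool}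
    {d : ℕ → Y → Bool} (hc : ∀ n, ContinuousOn (c n) {v}ᶜ) (hd : ∀ n, ContinuousOn (d n) {w}ᶜ) :
    ∃ (a : ℕ → X → ℕ) (b : ℕ → Y → ℕ) (σ τ : ℕ → ℕ → ℝ) (B : ℝ),
      (∀ n, Matched v w p q (a n) (b n) (σ n) (τ n)) ∧ (∀ j, |σ 0 j| ≤ B) ∧ (∀ j, |τ 0 j| ≤ B) ∧
      (∀ n x, a (n + 1) x / 2 / 2 = a n x) ∧ (∀ n y, b (n + 1) y / 2 / 2 = b n y) ∧
      (∀ n j, |σ (n + 1) j - σ n (j / 2 / 2)| ≤ 1 / 2 / 2 ^ n) ∧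
      (∀ n j, |τ (n + 1) j - τ n (j / 2 / 2)| ≤ 1 / 2 / 2 ^ n) ∧
      (∀ n x x', a (n + 1) x = a (n + 1) x' → c n x = c n x') ∧
      ∀ n y y', b (n + 1) y = b (n + 1) y' → d n y = d n y' := by
  obtain ⟨x₀, hx₀⟩ := hX
  obtain ⟨y₀, hy₀⟩ := hY
  have hs : 0 < sSup (p '' {x | x ≠ v}) := (hp.pos S hx₀).trans_le (hp.le_sSup hx₀)
  have ht : 0 < sSup (q '' {y | y ≠ w}) := (hq.pos T hy₀).trans_le (hq.le_sSup hy₀)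
  let r := Real.log (sSup (p '' {x | x ≠ v}) / sSup (q '' {y | y ≠ w}))
  have h0 : Matched v w p q (fun _ => 0) (fun _ => 0) (fun _ => 0) (fun _ => r) := by
    refine ⟨continuousOn_const, continuousOn_const, fun i => ?_⟩
    rcases eq_or_ne 0 i with rfl | hi
    · simp only [and_true, Real.exp_zero, one_mul, r]
      rw [Real.exp_log (div_pos hs ht), div_mul_cancel₀ _ ht.ne']
    · simp [hi]
  let St := {s : (X → ℕ) × (Y → ℕ) × (ℕ → ℝ) × (ℕ → ℝ) //
    Matched v w p q s.1 s.2.1 s.2.2.1 s.2.2.2}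
  have hstep : ∀ (n : ℕ) (s : St), ∃ t : St,
      (∀ x, t.1.1 x / 2 / 2 = s.1.1 x) ∧ (∀ y, t.1.2.1 y / 2 / 2 = s.1.2.1 y) ∧
      (∀ j, |t.1.2.2.1 j - s.1.2.2.1 (j / 2 / 2)| ≤ 1 / 2 / 2 ^ n) ∧
      (∀ j, |t.1.2.2.2 j - s.1.2.2.2 (j / 2 / 2)| ≤ 1 / 2 / 2 ^ n) ∧
      (∀ x x', t.1.1 x = t.1.1 x' → c n x = c n x') ∧
      ∀ y y', t.1.2.1 y = t.1.2.1 y' → d n y = d n y' := by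
    intro n s
    obtain ⟨a, b, σ, τ, hm, h⟩ := s.2.exists_refine_both hp S hq T (hc n) (hd n)
      (ε := 1 / 2 / 2 ^ n) (by positivity)
    exact ⟨⟨(a, b, σ, τ), hm⟩, h⟩
  choose next hnext using hstep
  let s : ℕ → St := fun n => Nat.rec ⟨(_, _, _, _), h0⟩ next n
  have hs' : ∀ n, s (n + 1) = next n (s n) := fun _ => rfl
  refine ⟨fun n => (s n).1.1, fun n => (s n).1.2.1, fun n => (s n).1.2.2.1,
    fun n => (s n).1.2.2.2, |r|, fun n => (s n).2,
    fun j => (abs_zero.trans_le (abs_nonneg r) :), fun j => (le_refl |r| :),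
    fun n => ?_, fun n => ?_, fun n => ?_, fun n => ?_, fun n => ?_, fun n => ?_⟩
  all_goals simp only [hs']
  exacts [(hnext n (s n)).1, (hnext n (s n)).2.1, (hnext n (s n)).2.2.1, (hnext n (s n)).2.2.2.1,
    (hnext n (s n)).2.2.2.2.1, (hnext n (s n)).2.2.2.2.2]

end Stages
end IsHeight

/-- Any two nondegenerate compact Lelek orders are homeomorphic. -/
theorem IsLelekOrder.nonempty_homeomorph {X Y : Type*} [MetricSpace X] [CompactSpace X]
    [MetricSpace Y] [CompactSpace Y] {v : X} {I : X → Set X} {w : Y} {J : Y → Set Y}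
    (S : IsLelekOrder v I) (T : IsLelekOrder w J) (hX : ∃ x, x ≠ v) (hY : ∃ y, y ≠ w) :
    Nonempty (X ≃ₜ Y) := by
  classical
  obtain ⟨p, hp⟩ := S.exists_isHeight
  obtain ⟨q, hq⟩ := T.exists_isHeight
  obtain ⟨c, hc, hcs⟩ := hp.exists_separating_seq S
  obtain ⟨d, hd, hds⟩ := hq.exists_separating_seq T
  obtain ⟨a, b, σ, τ, B, hm, hσ₀, hτ₀, ha, hb, hσ, hτ, hac, hbd⟩ :=
    hp.exists_matched_seq S hq T hX hY hc hd
  obtain ⟨P, hP, hPp⟩ := hp.exists_limit S (fun n => (hm n).left) ha hσ₀ hσ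
  obtain ⟨Q, hQ, hQq⟩ := hq.exists_limit T (fun n => (hm n).right) hb hτ₀ hτ
  have hinX : ∀ x x', x ≠ v → x' ≠ v → (∀ n, a n x = a n x') → P x = P x' → x = x' :=
    fun x x' hx hx' h he =>
      hP.eq_of_cmp (hcs x x' hx hx' fun n => hac n x x' (h (n + 1))) he
  have hinY : ∀ y y', y ≠ w → y' ≠ w → (∀ n, b n y = b n y') → Q y = Q y' → y = y' :=
    fun y y' hy hy' h he =>
      hQ.eq_of_cmp (hds y y' hy hy' fun n => hbd n y y' (h (n + 1))) he
  have hf : ∀ x, ∃ y, (x = v ∧ y = w) ∨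
      (x ≠ v ∧ y ≠ w ∧ (∀ n, a n x = b n y) ∧ P x = Q y) := by
    intro x
    by_cases hx : x = v
    · exact ⟨w, Or.inl ⟨hx, rfl⟩⟩
    · obtain ⟨y, hy⟩ := hp.exists_partner S hq T hP hQ hm ha hb (fun n x => (hPp n x).1)
        (fun n y => (hQq n y).2) hx
      exact ⟨y, Or.inr ⟨hx, hy⟩⟩
  choose F hF using hf
  have hFP : ∀ x, P x = Q (F x) := by
    intro x
    rcases hF x with ⟨hx, hy⟩ | h
    · rw [hx, ← hx, hy, hx, hP.root, hQ.root]
    · exact h.2.2.2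
  have hinj : Function.Injective F := by
    intro x x' h
    rcases hF x with ⟨hx, hy⟩ | h₁ <;> rcases hF x' with ⟨hx', hy'⟩ | h₂
    · rw [hx, hx']
    · exact absurd (h ▸ hy) h₂.2.1
    · exact absurd (h ▸ hy') h₁.2.1
    · exact hinX x x' h₁.1 h₂.1 (fun n => by rw [h₁.2.2.1, h₂.2.2.1, h]) (by rw [hFP, hFP, h])
  have hsurj : Function.Surjective F := by
    intro y
    by_cases hy : y = w
    · rcases hF v with h | h
      · exact ⟨v, h.2.trans hy.symm⟩
      · exact absurd rfl h.1
    · obtain ⟨x, hx, hxa, hxP⟩ := hq.exists_partner T hp S hQ hP (fun n => (hm n).symm) hb ha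
        (fun n y => (hQq n y).1) (fun n x => (hPp n x).2) hy
      refine ⟨x, ?_⟩
      rcases hF x with h | h
      · exact absurd h.1 hx
      · exact hinY _ _ h.2.1 hy (fun n => by rw [← h.2.2.1, hxa]) (by rw [← hFP, hxP])
  have hgraph : IsClosed {z : X × Y | z.2 = F z.1} := by
    have hset : {z : X × Y | z.2 = F z.1} = {z : X × Y | P z.1 = Q z.2} ∩
        ⋂ n, {z : X × Y | z.1 ≠ v ∧ z.2 ≠ w ∧ a n z.1 ≠ b n z.2}ᶜ := by
      ext ⟨x, y⟩
      simp only [mem_inter_iff, mem_iInter, mem_compl_iff]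
      constructor
      · rintro (rfl : y = F x)
        refine ⟨hFP x, fun n h => ?_⟩
        rcases hF x with h' | h'
        · exact h.1 h'.1
        · exact h.2.2 (h'.2.2.1 n)
      · rintro ⟨h₁, h₂⟩
        replace h₁ : P x = Q y := h₁
        show y = F x
        rcases hF x with ⟨hx, hy⟩ | h'
        · by_contra hne
          have := hQ.pos T (fun h => hne (h.trans hy.symm) : y ≠ w)
          rw [← h₁, hx, hP.root] at this
          exact lt_irrefl _ this
        · have hyw : y ≠ w := hQ.ne_root (h₁ ▸ hP.pos S h'.1)
          refine hinY _ _ hyw h'.2.1 (fun n => ?_) (by rw [← h₁, hFP])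
          rw [← h'.2.2.1]
          by_contra hne
          exact h₂ n ⟨h'.1, hyw, Ne.symm hne⟩
    rw [hset]
    refine (isClosed_eq (hP.cont.comp continuous_fst) (hQ.cont.comp continuous_snd)).inter
      (isClosed_iInter fun n => IsOpen.isClosed_compl ?_)
    have hcont : ContinuousOn (fun z : X × Y => (a n z.1, b n z.2)) ({v}ᶜ ×ˢ {w}ᶜ) :=
      ((hm n).left.comp continuousOn_fst fun z hz => hz.1).prodMk
        ((hm n).right.comp continuousOn_snd fun z hz => hz.2)
    convert hcont.isOpen_inter_preimage (isOpen_compl_singleton.prod isOpen_compl_singleton)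
      (isOpen_discrete {r : ℕ × ℕ | r.1 ≠ r.2}) using 1
    ext z
    exact (and_assoc (a := z.1 ≠ v) (b := z.2 ≠ w)).symm
  have hcont : Continuous F := by
    refine continuous_iff_isClosed.2 fun K hK => ?_
    convert isClosedMap_fst_of_compactSpace _ (hgraph.inter (hK.preimage continuous_snd)) using 1
    ext x
    constructor
    · intro hx
      exact ⟨(x, F x), ⟨rfl, hx⟩, rfl⟩
    · rintro ⟨⟨x', y⟩, ⟨h, hy⟩, rfl⟩
      replace h : y = F x' := h
      exact h ▸ hy
  exact ⟨Continuous.homeoOfEquivCompactToT2 (f := Equiv.ofBijective F ⟨hinj, hsurj⟩) hcont⟩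

section SimplePath

variable {X : Type*} [TopologicalSpace X]

/-- A real path which is an embedding of the unit interval. -/
structure IsSimplePath (γ : ℝ → X) : Prop where
  cont : Continuous γ
  inj : InjOn γ (Icc 0 1)

namespace IsSimplePath

variable {γ : ℝ → X}

lemma inter_subset (hγ : IsSimplePath γ) {s t r : ℝ} (ht : t ∈ Icc (0 : ℝ) 1) (hs : 0 ≤ s)
    (hr : r ≤ 1) : γ '' Icc s t ∩ γ '' Icc t r ⊆ {γ t} := by
  rintro _ ⟨⟨a, ha, rfl⟩, b, hb, hab⟩
  have : b = a := hγ.inj ⟨ht.1.trans hb.1, hb.2.trans hr⟩ ⟨hs.trans ha.1, ha.2.trans ht.2⟩ hab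
  have hat : a = t := le_antisymm ha.2 (this ▸ hb.1)
  rw [hat]
  rfl

variable [T2Space X]

lemma isClosed_image (hγ : IsSimplePath γ) (s t : ℝ) : IsClosed (γ '' Icc s t) :=
  (isCompact_Icc.image hγ.cont).isClosed

/-- A preconnected subset of a simple path contains with two points everything in between. -/
lemma mem_of_preconnected (hγ : IsSimplePath γ) {C : Set X} (hC : IsPreconnected C)
    (hC' : C ⊆ γ '' Icc 0 1) {s t r : ℝ} (hs : 0 ≤ s) (hst : s ≤ t) (htr : t ≤ r) (hr : r ≤ 1)
    (h₁ : γ s ∈ C) (h₂ : γ r ∈ C) : γ t ∈ C := by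
  obtain ⟨z, hz, hz'⟩ := isPreconnected_closed_iff.1 hC (γ '' Icc 0 t) (γ '' Icc t 1)
    (hγ.isClosed_image _ _) (hγ.isClosed_image _ _)
    (by
      rw [← image_union, Icc_union_Icc_eq_Icc (hs.trans hst) (htr.trans hr)]
      exact hC') ⟨_, h₁, s, ⟨hs, hst⟩, rfl⟩ ⟨_, h₂, r, ⟨htr, hr⟩, rfl⟩
  rw [← hγ.inter_subset ⟨hs.trans hst, htr.trans hr⟩ le_rfl le_rfl hz']
  exact hz

lemma not_isEndpointOfArc (hγ : IsSimplePath γ) {t : ℝ} (ht : t ∈ Ioo (0 : ℝ) 1) :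
    ¬ IsEndpointOfArc (γ '' Icc 0 1) (γ t) := by
  rintro ⟨φ, hφ⟩
  have hpc : IsPreconnected ((fun z => (φ z : X)) '' {z | z ≠ ⟨0, by norm_num⟩}) := by
    have h : {z : Icc (0 : ℝ) 1 | z ≠ ⟨0, by norm_num⟩} = Ioi ⟨0, by norm_num⟩ := by
      ext z
      exact ⟨fun h => lt_of_le_of_ne (show (⟨0, by norm_num⟩ : Icc (0 : ℝ) 1) ≤ z from z.2.1)
        (Ne.symm h), fun h => (ne_of_lt h).symm⟩
    rw [h]
    exact isPreconnected_Ioi.image _ (by fun_prop)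
  have hmem : ∀ s ∈ Icc (0 : ℝ) 1, s ≠ t →
      γ s ∈ (fun z => (φ z : X)) '' {z | z ≠ ⟨0, by norm_num⟩} := by
    intro s hs hst
    refine ⟨φ.symm ⟨γ s, s, hs, rfl⟩, fun h => hst ?_, by simp⟩
    refine hγ.inj hs ⟨ht.1.le, ht.2.le⟩ ?_
    rw [← hφ, ← h]
    simp
  obtain ⟨z, hz, hz'⟩ := hγ.mem_of_preconnected hpc
    (by rintro _ ⟨z, -, rfl⟩; exact (φ z).2) le_rfl ht.1.le ht.2.le le_rfl
    (hmem 0 (by simp) ht.1.ne) (hmem 1 (by simp) ht.2.ne')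
  exact hz (φ.injective (Subtype.ext (hz'.trans hφ.symm)))

end IsSimplePath

lemma IsArcFromTo.exists_path [T2Space X] {A : Set X} {v x : X} (h : IsArcFromTo A v x)
    (hx : v ≠ x) : ∃ γ : ℝ → X, IsSimplePath γ ∧ γ 0 = v ∧ γ 1 = x ∧ γ '' Icc 0 1 = A := by
  rcases h with h | ⟨-, -, ⟨φ, hφ⟩, hA⟩
  · exact absurd h.1 hx
  have hpath : IsSimplePath (IccExtend zero_le_one (fun t => (φ t : X))) := by
    refine ⟨Continuous.Icc_extend' (by fun_prop), fun s hs t ht hst => ?_⟩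
    rw [IccExtend_of_mem _ _ hs, IccExtend_of_mem _ _ ht] at hst
    exact congrArg Subtype.val (φ.injective (Subtype.ext hst))
  have h0 : IccExtend zero_le_one (fun t => (φ t : X)) 0 = v := by
    rw [IccExtend_of_mem _ _ (by simp : (0 : ℝ) ∈ Icc 0 1)]
    exact hφ
  have himg : IccExtend zero_le_one (fun t => (φ t : X)) '' Icc 0 1 = A := by
    ext z
    constructor
    · rintro ⟨t, ht, rfl⟩
      rw [IccExtend_of_mem _ _ ht]
      exact (φ _).2
    · intro hz
      refine ⟨φ.symm ⟨z, hz⟩, (φ.symm _).2, ?_⟩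
      rw [IccExtend_of_mem _ _ (φ.symm _).2]
      simp
  refine ⟨_, hpath, h0, ?_, himg⟩
  have hxA : x ∈ A := by
    obtain ⟨ψ, rfl⟩ := hA
    exact (ψ _).2
  obtain ⟨t, ht, rfl⟩ := himg ▸ hxA
  rcases eq_or_lt_of_le ht.1 with rfl | ht0
  · exact absurd h0.symm hx
  rcases eq_or_lt_of_le ht.2 with rfl | ht1
  · rfl
  · refine absurd ?_ (hpath.not_isEndpointOfArc ⟨ht0, ht1⟩)
    rw [himg]
    exact hA

lemma IsArcFromTo.isSubcontinuum {A : Set X} {v x : X} (h : IsArcFromTo A v x) :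
    IsSubcontinuum A ∧ v ∈ A ∧ x ∈ A := by
  rcases h with ⟨rfl, rfl⟩ | ⟨-, ⟨φ⟩, ⟨ψ, rfl⟩, ⟨χ, rfl⟩⟩
  · exact ⟨⟨isCompact_singleton, isConnected_singleton⟩, rfl, rfl⟩
  · have hr : range (fun t => (φ.symm t : X)) = A := by
      rw [show (fun t => (φ.symm t : X)) = Subtype.val ∘ φ.symm from rfl, range_comp,
        φ.symm.surjective.range_eq, image_univ,
        Subtype.range_coe]
    have hc : Continuous (fun t => (φ.symm t : X)) := by fun_prop
    refine ⟨?_, (ψ _).2, (χ _).2⟩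
    rw [← hr]
    have : ConnectedSpace (Icc (0 : ℝ) 1) :=
      Subtype.connectedSpace ⟨⟨0, by simp⟩, isPreconnected_Icc⟩
    exact ⟨isCompact_range hc, isConnected_range hc⟩

/-- The intersection of all closed connected sets containing `v` and `x`. -/
def leastContinuum (v x : X) : Set X :=
  ⋂₀ {K | IsClosed K ∧ IsPreconnected K ∧ v ∈ K ∧ x ∈ K}

lemma leastContinuum_subset {v x : X} {K : Set X} (h₁ : IsClosed K) (h₂ : IsPreconnected K)
    (hv : v ∈ K) (hx : x ∈ K) : leastContinuum v x ⊆ K :=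
  sInter_subset_of_mem ⟨h₁, h₂, hv, hx⟩

lemma self_mem_leastContinuum (v x : X) : x ∈ leastContinuum v x := fun _ h => h.2.2.2

lemma root_mem_leastContinuum (v x : X) : v ∈ leastContinuum v x := fun _ h => h.2.2.1

end SimplePath

section Dendroid

variable {X : Type*} [TopologicalSpace X] {v x y : X}

lemma IsDendroid.compactSpace (hD : IsDendroid (univ : Set X)) : CompactSpace X :=
  isCompact_univ_iff.1 hD.1.1

lemma IsDendroid.exists_isArcFromTo (hD : IsDendroid (univ : Set X)) (v x : X) :
    ∃ A, IsArcFromTo A v x := by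
  by_cases h : v = x
  · exact ⟨{v}, Or.inl ⟨h, rfl⟩⟩
  · obtain ⟨A, -, hA⟩ := hD.2.1 v (mem_univ _) x (mem_univ _) h
    exact ⟨A, Or.inr ⟨h, hA⟩⟩

lemma IsDendroid.preconnected_inter (hD : IsDendroid (univ : Set X)) {A B : Set X}
    (hA : IsClosed A) (hA' : IsPreconnected A) (hB : IsClosed B) (hB' : IsPreconnected B) :
    IsPreconnected (A ∩ B) := by
  have := hD.compactSpace
  rcases (A ∩ B).eq_empty_or_nonempty with h | ⟨x, hx⟩
  · rw [h]
    exact isPreconnected_empty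
  have hA'' : IsSubcontinuum A := ⟨hA.isCompact, ⟨x, hx.1⟩, hA'⟩
  have hB'' : IsSubcontinuum B := ⟨hB.isCompact, ⟨x, hx.2⟩, hB'⟩
  exact (hD.2.2 (A ∪ B) (subset_univ _) ⟨hA''.1.union hB''.1, hA''.2.union ⟨x, hx⟩ hB''.2⟩
    A B hA'' hB'' rfl).isPreconnected

variable [T2Space X]

lemma IsDendroid.leastContinuum_apply (hD : IsDendroid (univ : Set X)) {γ : ℝ → X}
    (hγ : IsSimplePath γ) {t : ℝ} (ht : t ∈ Icc (0 : ℝ) 1) :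
    leastContinuum (γ 0) (γ t) = γ '' Icc 0 t := by
  refine (leastContinuum_subset (hγ.isClosed_image _ _)
    (isPreconnected_Icc.image _ hγ.cont.continuousOn) ⟨0, ⟨le_rfl, ht.1⟩, rfl⟩
    ⟨t, ⟨ht.1, le_rfl⟩, rfl⟩).antisymm ?_
  rintro _ ⟨s, hs, rfl⟩ K ⟨hK, hK', h0, h1⟩
  exact (hγ.mem_of_preconnected (hD.preconnected_inter hK hK' (hγ.isClosed_image 0 1)
    (isPreconnected_Icc.image _ hγ.cont.continuousOn)) inter_subset_right le_rfl hs.1 hs.2 ht.2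
    ⟨h0, 0, by simp, rfl⟩ ⟨h1, t, ht, rfl⟩).1

lemma IsDendroid.leastContinuum_eq (hD : IsDendroid (univ : Set X)) {A : Set X}
    (hA : IsArcFromTo A v x) : leastContinuum v x = A := by
  by_cases h : v = x
  · subst h
    rcases hA with ⟨-, rfl⟩ | hA
    · exact (leastContinuum_subset isClosed_singleton isPreconnected_singleton rfl rfl).antisymm
        (singleton_subset_iff.2 (self_mem_leastContinuum v v))
    · exact absurd rfl hA.1
  · obtain ⟨γ, hγ, rfl, rfl, rfl⟩ := hA.exists_path h
    exact hD.leastContinuum_apply hγ (by simp)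

lemma IsDendroid.isArcFromTo (hD : IsDendroid (univ : Set X)) (v x : X) :
    IsArcFromTo (leastContinuum v x) v x := by
  obtain ⟨A, hA⟩ := hD.exists_isArcFromTo v x
  rwa [hD.leastContinuum_eq hA]

lemma IsDendroid.exists_path (hD : IsDendroid (univ : Set X)) (h : v ≠ x) :
    ∃ γ : ℝ → X, IsSimplePath γ ∧ γ 0 = v ∧ γ 1 = x ∧ γ '' Icc 0 1 = leastContinuum v x :=
  (hD.isArcFromTo v x).exists_path h

lemma IsDendroid.leastContinuum_isSubcontinuum (hD : IsDendroid (univ : Set X)) (v x : X) :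
    IsSubcontinuum (leastContinuum v x) :=
  (hD.isArcFromTo v x).isSubcontinuum.1

lemma IsDendroid.leastContinuum_trans (hD : IsDendroid (univ : Set X))
    (h : y ∈ leastContinuum v x) : leastContinuum v y ⊆ leastContinuum v x :=
  leastContinuum_subset (hD.leastContinuum_isSubcontinuum v x).1.isClosed
    (hD.leastContinuum_isSubcontinuum v x).2.isPreconnected (root_mem_leastContinuum v x) h

lemma IsDendroid.leastContinuum_root (hD : IsDendroid (univ : Set X)) (v : X) :
    leastContinuum v v = {v} :=
  hD.leastContinuum_eq (Or.inl ⟨rfl, rfl⟩)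

lemma IsDendroid.leastContinuum_antisymm (hD : IsDendroid (univ : Set X))
    (h₁ : y ∈ leastContinuum v x) (h₂ : x ∈ leastContinuum v y) : x = y := by
  by_cases h : v = x
  · subst h
    rw [hD.leastContinuum_root] at h₁
    exact h₁.symm
  obtain ⟨γ, hγ, rfl, rfl, hA⟩ := hD.exists_path h
  obtain ⟨t, ht, rfl⟩ := hA ▸ h₁
  rw [hD.leastContinuum_apply hγ ht] at h₂
  obtain ⟨s, hs, hs'⟩ := h₂
  have : s = 1 := hγ.inj ⟨hs.1, hs.2.trans ht.2⟩ (by simp) hs'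
  rw [le_antisymm ht.2 (this ▸ hs.2)]

lemma IsDendroid.leastContinuum_chain (hD : IsDendroid (univ : Set X)) {z : X}
    (h₁ : y ∈ leastContinuum v x) (h₂ : z ∈ leastContinuum v x) :
    y ∈ leastContinuum v z ∨ z ∈ leastContinuum v y := by
  by_cases h : v = x
  · subst h
    rw [hD.leastContinuum_root] at h₁ h₂
    rw [h₁, h₂]
    exact Or.inl (self_mem_leastContinuum v v)
  obtain ⟨γ, hγ, rfl, rfl, hA⟩ := hD.exists_path h
  obtain ⟨t, ht, rfl⟩ := hA ▸ h₁
  obtain ⟨s, hs, rfl⟩ := hA ▸ h₂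
  rw [hD.leastContinuum_apply hγ ht, hD.leastContinuum_apply hγ hs]
  rcases le_total t s with hts | hts
  · exact Or.inl ⟨t, ⟨ht.1, hts⟩, rfl⟩
  · exact Or.inr ⟨s, ⟨hs.1, hts⟩, rfl⟩

end Dendroid

section Triod

variable {X : Type*} [TopologicalSpace X] [T2Space X]

/-- Two simple paths with a common initial part which separate at interior points span a triod. -/
lemma exists_isSimpleTriodWithTop {γ η : ℝ → X} (hγ : IsSimplePath γ) (hη : IsSimplePath η)
    {s t : ℝ} (hs : s ∈ Ioo (0 : ℝ) 1) (ht : t ∈ Ico (0 : ℝ) 1) (hst : γ s = η t)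
    (hinter : γ '' Icc 0 1 ∩ η '' Icc 0 1 ⊆ η '' Icc 0 t) : ∃ T, IsSimpleTriodWithTop T (γ s) := by
  let g : ℝ → ℝ := fun r => s + s * min r 0 + (1 - s) * max r 0
  let k : ℝ → ℝ := fun r => t + (1 - t) * r
  have hgc : Continuous g := by fun_prop
  have hkc : Continuous k := by fun_prop
  have hg0 : g 0 = s := by simp [g]
  have hk0 : k 0 = t := by simp [k]
  have hs1 : 0 < 1 - s := by linarith [hs.2]
  have ht1 : 0 < 1 - t := by linarith [ht.2]
  have hgm : StrictMono g := by
    intro a b hab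
    have h1 := min_add_max a 0
    have h2 := min_add_max b 0
    have h3 : min a 0 ≤ min b 0 := min_le_min_right _ hab.le
    have h4 : max a 0 ≤ max b 0 := max_le_max_right _ hab.le
    simp only [g]
    rcases h3.lt_or_eq with h5 | h5
    · nlinarith [mul_lt_mul_of_pos_left h5 hs.1, mul_le_mul_of_nonneg_left h4 hs1.le]
    · have h6 : max a 0 < max b 0 := by linarith
      rw [h5]
      nlinarith [mul_lt_mul_of_pos_left h6 hs1]
  have hgI : ∀ r ∈ Icc (-1 : ℝ) 1, g r ∈ Icc (0 : ℝ) 1 := by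
    intro r hr
    have h1 : g (-1) = 0 := by simp [g]
    have h2 : g 1 = 1 := by simp [g]
    exact ⟨h1 ▸ hgm.monotone hr.1, h2 ▸ hgm.monotone hr.2⟩
  have hkI : ∀ r ∈ Icc (0 : ℝ) 1, k r ∈ Icc (0 : ℝ) 1 := by
    intro r hr
    simp only [k]
    exact ⟨by nlinarith [ht.1, hr.1], by nlinarith [hr.2]⟩
  have hne : ∀ a ∈ Icc (-1 : ℝ) 1, ∀ b ∈ Icc (0 : ℝ) 1, b ≠ 0 → γ (g a) ≠ η (k b) := by
    intro a ha b hb hb0 h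
    obtain ⟨c, hc, hc'⟩ := hinter ⟨⟨_, hgI a ha, h⟩, _, hkI b hb, rfl⟩
    have h1 := hη.inj ⟨hc.1, hc.2.trans ht.2.le⟩ (hkI b hb) hc'
    have h2 : 0 < b := lt_of_le_of_ne hb.1 (Ne.symm hb0)
    have h3 := hc.2
    rw [h1] at h3
    simp only [k] at h3
    nlinarith [mul_pos ht1 h2]
  classical
  let f : ℝ × ℝ → X := fun z => if z.2 = 0 then γ (g z.1) else η (k z.2)
  have hfc : ContinuousOn f triodModel := by
    refine ContinuousOn.union_of_isClosed ?_ ?_ (isClosed_Icc.prod isClosed_singleton)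
      (isClosed_singleton.prod isClosed_Icc)
    · refine (hγ.cont.comp (hgc.comp continuous_fst)).continuousOn.congr fun z hz => ?_
      exact if_pos hz.2
    · refine (hη.cont.comp (hkc.comp continuous_snd)).continuousOn.congr fun z hz => ?_
      simp only [f, Function.comp]
      split_ifs with h
      · rw [h, show z.1 = 0 from hz.1, hg0, hk0, hst]
      · rfl
  have hinj : InjOn f triodModel := by
    have hcase : ∀ z ∈ triodModel, (z.2 = 0 ∧ z.1 ∈ Icc (-1 : ℝ) 1) ∨
        (z.2 ≠ 0 ∧ z.1 = 0 ∧ z.2 ∈ Icc (0 : ℝ) 1) := by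
      rintro z (hz | hz)
      · exact Or.inl ⟨hz.2, hz.1⟩
      · by_cases h : z.2 = 0
        · refine Or.inl ⟨h, ?_⟩
          rw [show z.1 = 0 from hz.1]
          norm_num
        · exact Or.inr ⟨h, hz.1, hz.2⟩
    intro z hz z' hz' h
    simp only [f] at h
    rcases hcase z hz with ⟨h1, h2⟩ | ⟨h1, h2, h3⟩ <;>
      rcases hcase z' hz' with ⟨h1', h2'⟩ | ⟨h1', h2', h3'⟩
    · rw [if_pos h1, if_pos h1'] at h
      exact Prod.ext (hgm.injective (hγ.inj (hgI _ h2) (hgI _ h2') h)) (h1.trans h1'.symm)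
    · rw [if_pos h1, if_neg h1'] at h
      exact absurd h (hne _ h2 _ h3' h1')
    · rw [if_neg h1, if_pos h1'] at h
      exact absurd h.symm (hne _ h2' _ h3 h1)
    · rw [if_neg h1, if_neg h1'] at h
      have h4 : k z.2 = k z'.2 := hη.inj (hkI _ h3) (hkI _ h3') h
      simp only [k, add_right_inj, mul_eq_mul_left_iff, ht1.ne', or_false] at h4
      exact Prod.ext (h2.trans h2'.symm) h4
  have hcomp : CompactSpace triodModel := isCompact_iff_compactSpace.1
    ((isCompact_Icc.prod isCompact_singleton).union (isCompact_singleton.prod isCompact_Icc))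
  have hfc' := continuousOn_iff_continuous_domRestrict.1 hfc
  have hemb : IsEmbedding (triodModel.domRestrict f) :=
    (hfc'.isClosedEmbedding (injOn_iff_injective.1 hinj)).isEmbedding
  refine ⟨_, hemb.toHomeomorph, ?_⟩
  show f (0, 0) = γ s
  simp only [f, if_true, hg0]

end Triod

section Fan

variable {X : Type*} [TopologicalSpace X] {v x y z : X}

lemma IsRamificationPoint.exists_ne {K : Set X} (h : IsRamificationPoint K v) : ∃ x, x ≠ v := by
  obtain ⟨-, T, -, φ, rfl⟩ := h
  refine ⟨φ ⟨(1, 0), Or.inl ⟨by norm_num, rfl⟩⟩, fun h => ?_⟩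
  have := congrArg (fun z : triodModel => z.1.1) (φ.injective (Subtype.ext h))
  norm_num at this

variable [T2Space X]

lemma IsFanWithTop.unbranched (hF : IsFanWithTop (univ : Set X) v) (hx : x ≠ v)
    (hy : x ∈ leastContinuum v y) (hz : x ∈ leastContinuum v z) :
    y ∈ leastContinuum v z ∨ z ∈ leastContinuum v y := by
  have hD := hF.1.1
  by_contra! hcon
  have hvy : v ≠ y := by
    rintro rfl
    exact hcon.1 (root_mem_leastContinuum v z)
  have hvz : v ≠ z := by
    rintro rfl
    exact hcon.2 (root_mem_leastContinuum v y)
  obtain ⟨γ, hγ, hγ0, rfl, hγI⟩ := hD.exists_path hvy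
  obtain ⟨η, hη, hη0, rfl, hηI⟩ := hD.exists_path hvz
  have hpc := hD.preconnected_inter (hγ.isClosed_image 0 1)
    (isPreconnected_Icc.image _ hγ.cont.continuousOn) (hη.isClosed_image 0 1)
    (isPreconnected_Icc.image _ hη.cont.continuousOn)
  rw [← hγI] at hy hcon
  rw [← hηI] at hz hcon
  let A : Set ℝ := Icc 0 1 ∩ γ ⁻¹' (η '' Icc 0 1)
  have hA : IsCompact A := isCompact_Icc.inter_right ((hη.isClosed_image 0 1).preimage hγ.cont)
  have h0A : (0 : ℝ) ∈ A := ⟨by simp, 0, by simp, hη0.trans hγ0.symm⟩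
  obtain ⟨s, hs, hsmax⟩ := hA.exists_isGreatest ⟨0, h0A⟩
  obtain ⟨t, ht, hts⟩ := hs.2
  have hle : ∀ r ∈ Icc (0 : ℝ) 1, γ r ∈ η '' Icc 0 1 → r ≤ s := fun r hr h => hsmax ⟨hr, h⟩
  obtain ⟨r, hr, rfl⟩ := hy
  have hr0 : 0 < r := by
    rcases eq_or_lt_of_le hr.1 with rfl | h
    · exact absurd hγ0 hx
    · exact h
  have hs0 : 0 < s := hr0.trans_le (hle r hr hz)
  have hs1 : s < 1 := by
    rcases eq_or_lt_of_le hs.1.2 with rfl | h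
    · exact absurd hs.2 hcon.1
    · exact h
  have ht1 : t < 1 := by
    rcases eq_or_lt_of_le ht.2 with rfl | h
    · exact absurd ⟨s, hs.1, hts.symm⟩ hcon.2
    · exact h
  have hinter : γ '' Icc 0 1 ∩ η '' Icc 0 1 ⊆ η '' Icc 0 t := by
    rintro _ ⟨⟨a, ha, rfl⟩, h⟩
    have h1 : γ a ∈ leastContinuum (γ 0) (γ s) := by
      rw [hD.leastContinuum_apply hγ hs.1]
      exact ⟨a, ⟨ha.1, hle a ha h⟩, rfl⟩
    rwa [hγ0, ← hη0, ← hts, hD.leastContinuum_apply hη ht] at h1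
  obtain ⟨T, hT⟩ := exists_isSimpleTriodWithTop hγ hη ⟨hs0, hs1⟩ ⟨ht.1, ht1⟩ hts.symm hinter
  have hsv := hF.1.2 _ _ ⟨mem_univ _, T, subset_univ _, hT⟩ hF.2
  exact hs0.ne (hγ.inj (by simp) hs.1 (hγ0.trans hsv.symm))

lemma IsFanWithTop.comparable (hF : IsFanWithTop (univ : Set X) v) {K : Set X} (hK : IsClosed K)
    (hK' : IsPreconnected K) (hv : v ∉ K) (hx : x ∈ K) (hy : y ∈ K) :
    x ∈ leastContinuum v y ∨ y ∈ leastContinuum v x := by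
  have hD := hF.1.1
  by_contra hcon
  have hx' := hD.leastContinuum_isSubcontinuum v x
  have hy' := hD.leastContinuum_isSubcontinuum v y
  have hpc := hD.preconnected_inter hK hK' (hx'.1.isClosed.union hy'.1.isClosed)
    (hx'.2.union ⟨v, root_mem_leastContinuum v x, root_mem_leastContinuum v y⟩ hy'.2).isPreconnected
  obtain ⟨z, hz, hz₁, hz₂⟩ := isPreconnected_closed_iff.1 hpc _ _ hx'.1.isClosed hy'.1.isClosed
    inter_subset_right ⟨x, ⟨hx, Or.inl (self_mem_leastContinuum v x)⟩, self_mem_leastContinuum v x⟩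
    ⟨y, ⟨hy, Or.inr (self_mem_leastContinuum v y)⟩, self_mem_leastContinuum v y⟩
  exact hcon (hF.unbranched (fun h => hv (h ▸ hz.1)) hz₁ hz₂)

lemma IsDendroid.eq_of_isEndpoint (hD : IsDendroid (univ : Set X))
    (hx : IsEndpoint (univ : Set X) x)
    (hxv : x ≠ v) (hxy : x ∈ leastContinuum v y) : y = x := by
  have hvy : v ≠ y := by
    rintro rfl
    rw [hD.leastContinuum_root] at hxy
    exact hxv hxy
  obtain ⟨γ, hγ, rfl, rfl, hI⟩ := hD.exists_path hvy
  have harc := hD.isArcFromTo (γ 0) (γ 1)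
  rcases harc with h | h
  · exact absurd h.1 hvy
  have hend := hx.2 _ (subset_univ _) h.2.1 hxy
  rw [← hI] at hend
  obtain ⟨t, ht, rfl⟩ := hI ▸ hxy
  rcases eq_or_lt_of_le ht.1 with rfl | ht0
  · exact absurd rfl hxv
  rcases eq_or_lt_of_le ht.2 with rfl | ht1
  · rfl
  · exact absurd hend (hγ.not_isEndpointOfArc ⟨ht0, ht1⟩)

end Fan

section Smooth

variable {X : Type*} [MetricSpace X] {v : X}

lemma IsLelekFan.compactSpace (h : IsLelekFan (univ : Set X) v) : CompactSpace X :=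
  h.1.1.1.1.compactSpace

lemma IsSmoothFan.tendsto_infDist (h : IsSmoothFan (univ : Set X) v) {x : X} {xs : ℕ → X}
    (hx : Tendsto xs atTop (𝓝 x)) :
    (∀ ε > 0, ∀ᶠ n in atTop, ∀ y ∈ leastContinuum v (xs n),
      Metric.infDist y (leastContinuum v x) < ε) ∧
    ∀ y ∈ leastContinuum v x, ∀ ε > 0, ∀ᶠ n in atTop,
      Metric.infDist y (leastContinuum v (xs n)) < ε := by
  have hD := h.1.1.1
  have hlim := h.2 x (mem_univ _) xs (fun _ => mem_univ _) hx _ (subset_univ _)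
    (hD.isArcFromTo v x) (fun n => leastContinuum v (xs n))
    fun n => ⟨subset_univ _, hD.isArcFromTo v (xs n)⟩
  have hfin : ∀ a b, Metric.hausdorffEDist (leastContinuum v a) (leastContinuum v b) ≠ ⊤ :=
    fun a b => Metric.hausdorffEDist_ne_top_of_nonempty_of_bounded ⟨_, root_mem_leastContinuum v a⟩
      ⟨_, root_mem_leastContinuum v b⟩ (hD.leastContinuum_isSubcontinuum v a).1.isBounded
      (hD.leastContinuum_isSubcontinuum v b).1.isBounded
  refine ⟨fun ε hε => ?_, fun y hy ε hε => ?_⟩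
  · filter_upwards [hlim.eventually (gt_mem_nhds hε)] with n hn y hy
    exact (Metric.infDist_le_hausdorffDist_of_mem hy (hfin _ _)).trans_lt hn
  · filter_upwards [hlim.eventually (gt_mem_nhds hε)] with n hn
    rw [Metric.hausdorffDist_comm] at hn
    exact (Metric.infDist_le_hausdorffDist_of_mem hy (hfin _ _)).trans_lt hn

theorem IsLelekFan.isLelekOrder (h : IsLelekFan (univ : Set X) v) :
    IsLelekOrder v (leastContinuum v) := by
  have hD := h.1.1.1.1
  have := h.compactSpace
  have hconn : ConnectedSpace X := connectedSpace_iff_univ.2 hD.1.2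
  refine ⟨self_mem_leastContinuum v, root_mem_leastContinuum v, hD.leastContinuum_trans,
    hD.leastContinuum_antisymm, hD.leastContinuum_chain, h.1.1.unbranched,
    fun x => (hD.leastContinuum_isSubcontinuum v x).2.isPreconnected, ?_, fun V hV => ?_,
    fun K hK hK' hv x hx y hy => h.1.1.comparable hK hK' hv hx hy, ?_⟩
  · refine isSeqClosed_iff_isClosed.1 fun q r hq hr => ?_
    have h1 := (h.1.tendsto_infDist ((continuous_fst.tendsto r).comp hr)).1
    have hcl := (hD.leastContinuum_isSubcontinuum v r.1).1.isClosed
    show r.2 ∈ leastContinuum v r.1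
    rw [hcl.mem_iff_infDist_zero ⟨_, root_mem_leastContinuum v _⟩]
    refine le_antisymm (le_of_forall_pos_lt_add fun ε hε => ?_) Metric.infDist_nonneg
    have h2 : Tendsto (fun n => Metric.infDist (q n).2 (leastContinuum v r.1)) atTop
        (𝓝 (Metric.infDist r.2 (leastContinuum v r.1))) :=
      ((Metric.continuous_infDist_pt _).tendsto _).comp ((continuous_snd.tendsto r).comp hr)
    have h3 := le_of_tendsto h2 ((h1 (ε / 2) (half_pos hε)).mono fun n hn => (hn _ (hq n)).le)
    linarith
  · rw [← isClosed_compl_iff]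
    refine isSeqClosed_iff_isClosed.1 fun xs x hxs hx => ?_
    rintro ⟨y, hy, hyV⟩
    obtain ⟨ε, hε, hball⟩ := Metric.isOpen_iff.1 hV y hyV
    obtain ⟨n, hn⟩ := ((h.1.tendsto_infDist hx).2 y hy ε hε).exists
    obtain ⟨z, hz, hyz⟩ := (Metric.infDist_lt_iff ⟨_, root_mem_leastContinuum v _⟩).1 hn
    exact hxs n ⟨z, hz, hball (by rwa [Metric.mem_ball, dist_comm])⟩
  · have : Nontrivial X := by
      obtain ⟨x, hx⟩ := h.1.1.2.exists_ne
      exact ⟨x, v, hx⟩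
    have hdense : Dense {x | IsEndpoint (univ : Set X) x} := fun x => h.2 (mem_univ x)
    have := ConnectedSpace.neBot_nhdsWithin_compl_of_nontrivial_of_t1space v
    refine (hdense.inter_of_isOpen_right (dense_compl_singleton v) isOpen_compl_singleton).mono ?_
    rintro x ⟨hx, hxv⟩ y hxy
    exact hD.eq_of_isEndpoint hx hxv hxy

end Smooth

section Transport

variable {X Y : Type*} [TopologicalSpace X] [TopologicalSpace Y]

lemma Homeomorph.image_symm_image' (h : X ≃ₜ Y) (A : Set Y) : h '' (h.symm '' A) = A := by
  rw [← image_comp]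
  simp

lemma IsSubcontinuum.image (h : X ≃ₜ Y) {A : Set X} (hA : IsSubcontinuum A) :
    IsSubcontinuum (h '' A) :=
  ⟨hA.1.image h.continuous, hA.2.image h h.continuous.continuousOn⟩

lemma IsArc.image (h : X ≃ₜ Y) {A : Set X} (hA : IsArc A) : IsArc (h '' A) :=
  hA.map fun φ => (h.image A).symm.trans φ

lemma IsEndpointOfArc.image (h : X ≃ₜ Y) {A : Set X} {x : X} (hA : IsEndpointOfArc A x) :
    IsEndpointOfArc (h '' A) (h x) := by
  obtain ⟨φ, rfl⟩ := hA
  exact ⟨φ.trans (h.image A), rfl⟩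

lemma IsSimpleTriodWithTop.image (h : X ≃ₜ Y) {A : Set X} {x : X} (hA : IsSimpleTriodWithTop A x) :
    IsSimpleTriodWithTop (h '' A) (h x) := by
  obtain ⟨φ, rfl⟩ := hA
  exact ⟨φ.trans (h.image A), rfl⟩

lemma IsArcFromTo.image (h : X ≃ₜ Y) {A : Set X} {x y : X} (hA : IsArcFromTo A x y) :
    IsArcFromTo (h '' A) (h x) (h y) := by
  rcases hA with ⟨rfl, rfl⟩ | ⟨hne, hA, hx, hy⟩
  · exact Or.inl ⟨rfl, image_singleton⟩
  · exact Or.inr ⟨h.injective.ne hne, hA.image h, hx.image h, hy.image h⟩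

lemma IsUnicoherent.image (h : X ≃ₜ Y) {A : Set X} (hA : IsUnicoherent A) :
    IsUnicoherent (h '' A) := by
  intro B C hB hC hBC
  have := hA _ _ (hB.image h.symm) (hC.image h.symm) (by
    rw [← image_union, hBC]
    exact h.symm.image_symm_image' A)
  rw [← image_inter h.symm.injective] at this
  rw [← h.image_symm_image' (B ∩ C)]
  exact this.image h h.continuous.continuousOn

lemma IsDendroid.map_univ (h : X ≃ₜ Y) (hD : IsDendroid (univ : Set X)) :
    IsDendroid (univ : Set Y) := by
  refine ⟨?_, fun x _ y _ hxy => ?_, fun A _ hA => ?_⟩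
  · simpa using hD.1.image h
  · obtain ⟨A, -, hA⟩ := hD.2.1 (h.symm x) (mem_univ _) (h.symm y) (mem_univ _)
      (h.symm.injective.ne hxy)
    refine ⟨h '' A, subset_univ _, hA.1.image h, ?_, ?_⟩
    · simpa using hA.2.1.image h
    · simpa using hA.2.2.image h
  · have := (hD.2.2 _ (subset_univ _) (hA.image h.symm)).image h
    rwa [h.image_symm_image'] at this

lemma IsRamificationPoint.map_univ (h : X ≃ₜ Y) {x : X}
    (hx : IsRamificationPoint (univ : Set X) x) :
    IsRamificationPoint (univ : Set Y) (h x) := by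
  obtain ⟨-, T, -, hT⟩ := hx
  exact ⟨mem_univ _, h '' T, subset_univ _, hT.image h⟩

lemma IsEndpoint.map_univ (h : X ≃ₜ Y) {x : X} (hx : IsEndpoint (univ : Set X) x) :
    IsEndpoint (univ : Set Y) (h x) := by
  refine ⟨mem_univ _, fun A _ hA hxA => ?_⟩
  have := (hx.2 _ (subset_univ _) (hA.image h.symm) ⟨_, hxA, by simp⟩).image h
  rwa [h.image_symm_image'] at this

lemma IsFanWithTop.map_univ (h : X ≃ₜ Y) {v : X} (hF : IsFanWithTop (univ : Set X) v) :
    IsFanWithTop (univ : Set Y) (h v) :=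
  ⟨⟨hF.1.1.map_univ h, fun _ _ hx hy => h.symm.injective
    (hF.1.2 _ _ (hx.map_univ h.symm) (hy.map_univ h.symm))⟩, hF.2.map_univ h⟩

end Transport

theorem IsLelekFan.map_univ {X Y : Type*} [MetricSpace X] [MetricSpace Y] (h : X ≃ₜ Y) {v : X}
    (hL : IsLelekFan (univ : Set X) v) : IsLelekFan (univ : Set Y) (h v) := by
  have := hL.compactSpace
  refine ⟨⟨hL.1.1.map_univ h, fun x _ xs _ hx A _ hA As hAs => ?_⟩, fun y _ => ?_⟩
  · have hlim := hL.1.2 (h.symm x) (mem_univ _) (fun n => h.symm (xs n)) (fun _ => mem_univ _)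
      ((h.symm.continuous.tendsto x).comp hx) (h.symm '' A) (subset_univ _)
      (by simpa using hA.image h.symm) (fun n => h.symm '' As n)
      fun n => ⟨subset_univ _, by simpa using (hAs n).2.image h.symm⟩
    have huc := Metric.uniformContinuous_iff.1
      (CompactSpace.uniformContinuous_of_continuous h.continuous)
    have hfin : ∀ n, Metric.hausdorffEDist (h.symm '' As n) (h.symm '' A) ≠ ⊤ := fun n =>
      Metric.hausdorffEDist_ne_top_of_nonempty_of_bounded
        (((hAs n).2.isSubcontinuum.1.image h.symm).2.nonempty)
        ((hA.isSubcontinuum.1.image h.symm).2.nonempty)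
        ((hAs n).2.isSubcontinuum.1.image h.symm).1.isBounded
        (hA.isSubcontinuum.1.image h.symm).1.isBounded
    rw [Metric.tendsto_atTop] at hlim ⊢
    intro ε hε
    obtain ⟨δ, hδ, hd⟩ := huc (ε / 2) (half_pos hε)
    obtain ⟨N, hN⟩ := hlim δ hδ
    refine ⟨N, fun n hn => ?_⟩
    have hn' := hN n hn
    rw [Real.dist_0_eq_abs, abs_of_nonneg Metric.hausdorffDist_nonneg] at hn' ⊢
    refine lt_of_le_of_lt (Metric.hausdorffDist_le_of_mem_dist (half_pos hε).le
      (fun a ha => ?_) fun a ha => ?_) (half_lt_self hε)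
    · obtain ⟨_, ⟨b, hb, rfl⟩, hab⟩ := Metric.exists_dist_lt_of_hausdorffDist_lt
        (mem_image_of_mem h.symm ha) hn' (hfin n)
      exact ⟨b, hb, by simpa using (hd hab).le⟩
    · obtain ⟨_, ⟨b, hb, rfl⟩, hab⟩ := Metric.exists_dist_lt_of_hausdorffDist_lt'
        (mem_image_of_mem h.symm ha) hn' (hfin n)
      refine ⟨b, hb, ?_⟩
      rw [dist_comm]
      simpa using (hd hab).le
  · have h1 : h '' closure {x | IsEndpoint (univ : Set X) x} ⊆
        closure {y | IsEndpoint (univ : Set Y) y} := by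
      rw [h.image_closure]
      refine closure_mono ?_
      rintro _ ⟨x, hx, rfl⟩
      exact IsEndpoint.map_univ h hx
    exact h1 ⟨h.symm y, hL.2 (mem_univ _), by simp⟩

/-- Open maps of compact spaces are confluent. -/
lemma IsOpenMap.exists_preconnected_image_eq {X Y : Type*} [TopologicalSpace X] [CompactSpace X]
    [T2Space X] [TopologicalSpace Y] [T2Space Y] {f : X → Y} (ho : IsOpenMap f) (hf : Continuous f)
    {Q : Set Y} (hQ : IsClosed Q) (hQ' : IsPreconnected Q) {x : X}
    (hx : f x ∈ Q) : ∃ K : Set X, IsClosed K ∧ IsPreconnected K ∧ x ∈ K ∧ f '' K = Q := by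
  have hPc : IsClosed (f ⁻¹' Q) := hQ.preimage hf
  have : CompactSpace (f ⁻¹' Q) := isCompact_iff_compactSpace.1 hPc.isCompact
  have : PreconnectedSpace Q := Subtype.preconnectedSpace hQ'
  let g : f ⁻¹' Q → Q := Q.restrictPreimage f
  have hg : Continuous g := hf.restrictPreimage
  have hgo : IsOpenMap g := ho.restrictPreimage Q
  let a : f ⁻¹' Q := ⟨x, hx⟩
  refine ⟨Subtype.val '' connectedComponent a,
    hPc.isClosedEmbedding_subtypeVal.isClosedMap _ isClosed_connectedComponent,
    isPreconnected_connectedComponent.image _ continuous_subtype_val.continuousOn,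
    ⟨a, mem_connectedComponent, rfl⟩, ?_⟩
  refine subset_antisymm ?_ fun y hy => ?_
  · rintro _ ⟨_, ⟨z, -, rfl⟩, rfl⟩
    exact z.2
  let F : {s : Set (f ⁻¹' Q) // IsClopen s ∧ a ∈ s} → Set (f ⁻¹' Q) :=
    fun s => s.1 ∩ g ⁻¹' {⟨y, hy⟩}
  have hFc : ∀ s, IsClosed (F s) := fun s => s.2.1.isClosed.inter (isClosed_singleton.preimage hg)
  have hne : Nonempty {s : Set (f ⁻¹' Q) // IsClopen s ∧ a ∈ s} :=
    ⟨⟨univ, isClopen_univ, mem_univ _⟩⟩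
  obtain ⟨z, hz⟩ := IsCompact.nonempty_iInter_of_directed_nonempty_isCompact_isClosed F
    (fun s t => ⟨⟨s.1 ∩ t.1, s.2.1.inter t.2.1, s.2.2, t.2.2⟩, fun z hz => ⟨hz.1.1, hz.2⟩,
      fun z hz => ⟨hz.1.2, hz.2⟩⟩)
    (fun s => by
      have hcl : IsClopen (g '' s.1) :=
        ⟨(s.2.1.isClosed.isCompact.image hg).isClosed, hgo _ s.2.1.isOpen⟩
      have := hcl.eq_univ ⟨_, mem_image_of_mem g s.2.2⟩
      obtain ⟨z, hz, hzy⟩ : (⟨y, hy⟩ : Q) ∈ g '' s.1 := this ▸ mem_univ _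
      exact ⟨z, hz, hzy⟩) (fun s => (hFc s).isCompact) hFc
  rw [mem_iInter] at hz
  refine ⟨z, ⟨z, ?_, rfl⟩, congrArg Subtype.val (hz ⟨univ, isClopen_univ, mem_univ _⟩).2⟩
  rw [connectedComponent_eq_iInter_isClopen, mem_iInter]
  exact fun s => (hz s).1

/-- An open map from a space with a Lelek order whose sets `I x` are least among the continua
joining `v` and `x`. -/
structure IsOpenLelekMap {X Y : Type*} [TopologicalSpace X] [TopologicalSpace Y] (v : X)
    (I : X → Set X) (f : X → Y) : Prop where
  order : IsLelekOrder v I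
  least : ∀ K : Set X, IsClosed K → IsPreconnected K → v ∈ K → ∀ x ∈ K, I x ⊆ K
  cont : Continuous f
  isOpenMap : IsOpenMap f
  surj : Function.Surjective f

namespace IsOpenLelekMap

variable {X Y : Type*} [MetricSpace X] [MetricSpace Y] {v : X} {I : X → Set X}
  {f : X → Y}

/-- The segment from `a` to `x`. -/
def seg (I : X → Set X) (a x : X) : Set X := {z | z ∈ I x ∧ a ∈ I z}

lemma isClosed_seg (H : IsOpenLelekMap v I f) (a x : X) : IsClosed (seg I a x) :=
  (H.order.isClosed_mem x).inter (H.order.isClosed_above a)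

lemma preconnected_image (H : IsOpenLelekMap v I f) {K : Set X} (hK : IsPreconnected K) :
    IsPreconnected (f '' K) :=
  hK.image f H.cont.continuousOn

lemma seg_subset (H : IsOpenLelekMap v I f) {K : Set X} (hK : IsClosed K) (hK' : IsPreconnected K)
    {a e : X} (ha : a ∈ K) (he : e ∈ K) : seg I a e ⊆ K := by
  have S := H.order
  by_cases hv : v ∈ K
  · exact fun z hz => H.least K hK hK' hv e he hz.1
  rintro b ⟨hb, hab⟩
  obtain ⟨z, hz, hz₁, hz₂⟩ := isPreconnected_closed_iff.1 hK' _ _ (S.isClosed_mem b)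
    (S.isClosed_above b) (fun k hk => by
      rcases S.comparable K hK hK' hv k hk e he with h | h
      · exact S.chain h hb
      · exact Or.inr (S.trans h hb)) ⟨a, ha, hab⟩ ⟨e, he, hb⟩
  rwa [S.antisymm hz₁ hz₂]

lemma subset_of_maximal (H : IsOpenLelekMap v I f) {K : Set X} (hK : IsClosed K)
    (hK' : IsPreconnected K) (hv : v ∉ K) {e : X} (he : ∀ y, e ∈ I y → y = e) (heK : e ∈ K) :
    K ⊆ I e := by
  intro k hk
  rcases H.order.comparable K hK hK' hv k hk e heK with h | h
  · exact h
  · rw [he k h]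
    exact H.order.self_mem e

lemma exists_maximal (H : IsOpenLelekMap v I f) {U : Set X} (hU : IsOpen U) (hne : U.Nonempty) :
    ∃ e ∈ U, ∀ y, e ∈ I y → y = e := by
  obtain ⟨e, he, he'⟩ := H.order.dense_max.inter_open_nonempty U hU hne
  exact ⟨e, he, he'⟩

lemma root_mem_small (H : IsOpenLelekMap v I f) {r : ℝ} (hr : 0 < r) :
    v ∈ {x | I x ⊆ f ⁻¹' Metric.ball (f v) r} := by
  intro y hy
  rw [H.order.eq_root hy]
  exact Metric.mem_ball_self hr

variable [CompactSpace X]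

lemma preconnected_seg (H : IsOpenLelekMap v I f) {a x : X} (h : a ∈ I x) :
    IsPreconnected (seg I a x) := by
  obtain ⟨p, hp⟩ := H.order.exists_isHeight
  exact hp.preconnected_segment H.order h

lemma isClosed_image (H : IsOpenLelekMap v I f) {K : Set X} (hK : IsClosed K) :
    IsClosed (f '' K) :=
  (hK.isCompact.image H.cont).isClosed

lemma exists_lift (H : IsOpenLelekMap v I f) {Q : Set Y} (hQ : IsClosed Q)
    (hQ' : IsPreconnected Q) {x : X} (hx : f x ∈ Q) :
    ∃ K : Set X, IsClosed K ∧ IsPreconnected K ∧ x ∈ K ∧ f '' K = Q :=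
  H.isOpenMap.exists_preconnected_image_eq H.cont hQ hQ' hx

lemma isOpen_subset (H : IsOpenLelekMap v I f) {W : Set X} (hW : IsOpen W) :
    IsOpen {x | I x ⊆ W} := by
  have h := isClosedMap_fst_of_compactSpace _
    (H.order.closed_graph.inter (hW.isClosed_compl.preimage continuous_snd))
  rw [← isClosed_compl_iff]
  convert h using 1
  ext x
  simp only [mem_compl_iff]
  constructor
  · intro hx
    obtain ⟨y, hy, hyW⟩ := not_subset.1 (show ¬ I x ⊆ W from hx)
    exact ⟨(x, y), ⟨hy, hyW⟩, rfl⟩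
  · rintro ⟨⟨x', y⟩, ⟨h₁, h₂⟩, rfl⟩ h₃
    exact h₂ (h₃ h₁)

/-- Continua through the image of a maximal point are nested or both contain the image of the
whole arc. -/
lemma nested_or (H : IsOpenLelekMap v I f) {e : X} (he : ∀ y, e ∈ I y → y = e) {Q R : Set Y}
    (hQ : IsClosed Q) (hQ' : IsPreconnected Q) (hR : IsClosed R) (hR' : IsPreconnected R)
    (heQ : f e ∈ Q) (heR : f e ∈ R) : Q ⊆ R ∨ R ⊆ Q ∨ (f '' I e ⊆ Q ∧ f '' I e ⊆ R) := by
  have S := H.order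
  obtain ⟨K, hK, hK', heK, rfl⟩ := H.exists_lift hQ hQ' heQ
  obtain ⟨M, hM, hM', heM, rfl⟩ := H.exists_lift hR hR' heR
  by_cases hvK : v ∈ K
  · have h₁ := H.least K hK hK' hvK e heK
    by_cases hvM : v ∈ M
    · exact Or.inr (Or.inr ⟨image_mono h₁, image_mono (H.least M hM hM' hvM e heM)⟩)
    · exact Or.inr (Or.inl (image_mono ((H.subset_of_maximal hM hM' hvM he heM).trans h₁)))
  · have h₁ := H.subset_of_maximal hK hK' hvK he heK
    by_cases hvM : v ∈ M
    · exact Or.inl (image_mono (h₁.trans (H.least M hM hM' hvM e heM)))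
    have h₂ := H.subset_of_maximal hM hM' hvM he heM
    by_cases hsub : K ⊆ M
    · exact Or.inl (image_mono hsub)
    refine Or.inr (Or.inl (image_mono fun b hb => ?_))
    obtain ⟨a, haK, haM⟩ := not_subset.1 hsub
    rcases S.chain (h₁ haK) (h₂ hb) with h | h
    · exact H.seg_subset hK hK' haK heK ⟨h₂ hb, h⟩
    · exact absurd (H.seg_subset hM hM' hb heM ⟨h₁ haK, h⟩) haM

lemma isOpen_small (H : IsOpenLelekMap v I f) (r : ℝ) :
    IsOpen {x | I x ⊆ f ⁻¹' Metric.ball (f v) r} :=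
  H.isOpen_subset (Metric.isOpen_ball.preimage H.cont)

lemma exists_small_ne [ConnectedSpace Y] [Nontrivial Y] (H : IsOpenLelekMap v I f) {r : ℝ}
    (hr : 0 < r) : ∃ x, I x ⊆ f ⁻¹' Metric.ball (f v) r ∧ f x ≠ f v := by
  have := ConnectedSpace.neBot_nhdsWithin_compl_of_nontrivial_of_t1space (f v)
  obtain ⟨y, ⟨x, hx, rfl⟩, hy⟩ := (dense_compl_singleton (f v)).inter_open_nonempty _
    (H.isOpenMap _ (H.isOpen_small r)) ⟨_, mem_image_of_mem f (H.root_mem_small hr)⟩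
  exact ⟨x, hx, hy⟩

lemma subset_or_subset_of_return (H : IsOpenLelekMap v I f) {z z₀ : X} (hz : f z = f v)
    (hz₀ : z₀ ∈ I z) {δ : ℝ} (hδ : δ < dist (f z₀) (f v)) (hδ0 : 0 < δ) {B C : Set Y}
    (hB : IsClosed B) (hB' : IsPreconnected B) (hC : IsClosed C) (hC' : IsPreconnected C)
    (hvB : f v ∈ B) (hvC : f v ∈ C) (hBδ : B ⊆ Metric.ball (f v) δ) : B ⊆ C ∨ C ⊆ B := by
  by_contra! hcon
  obtain ⟨⟨b, hb, hbC⟩, c, hc, hcB⟩ := hcon.imp not_subset.1 not_subset.1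
  have hbv : 0 < dist b (f v) := dist_pos.2 fun h => hbC (h ▸ hvC)
  have hcv : 0 < dist c (f v) := dist_pos.2 fun h => hcB (h ▸ hvB)
  let η := min δ (min (dist b (f v)) (dist c (f v)))
  have hη : 0 < η := lt_min hδ0 (lt_min hbv hcv)
  have hVo : IsOpen {u | δ < dist (f u) (f v)} :=
    isOpen_lt continuous_const (H.cont.dist continuous_const)
  obtain ⟨e, ⟨⟨x, hx, hxe⟩, u, hu, huV⟩, hmax⟩ := H.exists_maximal
    (((H.isOpenMap _ (H.isOpen_small η)).preimage H.cont).inter (H.order.lower _ hVo))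
    ⟨z, ⟨v, H.root_mem_small hη, hz.symm⟩, z₀, hz₀, hδ⟩
  have hxη : f '' I x ⊆ Metric.ball (f v) η := image_subset_iff.2 hx
  have hvx : f v ∈ f '' I x := mem_image_of_mem f (H.order.root_mem x)
  have hex : f e ∈ f '' I x := ⟨x, H.order.self_mem x, hxe⟩
  have hIc := H.isClosed_image (H.order.isClosed_mem x)
  have hIp := H.preconnected_image (H.order.preconnected x)
  rcases H.nested_or hmax (hB.union hIc) (hB'.union (f v) hvB hvx hIp) (hC.union hIc)
    (hC'.union (f v) hvC hvx hIp) (Or.inr hex) (Or.inr hex) with h | h | h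
  · rcases h (Or.inl hb) with h' | h'
    · exact hbC h'
    · have : dist b (f v) < η := hxη h'
      exact absurd this (not_lt.2 ((min_le_right _ _).trans (min_le_left _ _)))
  · rcases h (Or.inl hc) with h' | h'
    · exact hcB h'
    · have : dist c (f v) < η := hxη h'
      exact absurd this (not_lt.2 ((min_le_right _ _).trans (min_le_right _ _)))
  · have h' : f u ∈ Metric.ball (f v) δ := by
      rcases h.1 ⟨u, hu, rfl⟩ with h' | h'
      · exact hBδ h'
      · exact Metric.ball_subset_ball (min_le_left _ _) (hxη h')
    have huV' : δ < dist (f u) (f v) := huV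
    exact absurd h' (not_lt.2 huV'.le)

lemma eq_root_of_mem [ConnectedSpace Y] [Nontrivial Y] (H : IsOpenLelekMap v I f) {z z₀ : X}
    (hz : f z = f v) (hz₀ : z₀ ∈ I z) : f z₀ = f v := by
  have S := H.order
  by_contra hne
  have hd : 0 < dist (f z₀) (f v) := dist_pos.2 hne
  obtain ⟨x₁, hx₁, hy₁⟩ := H.exists_small_ne (half_pos hd)
  have hd₁ : 0 < dist (f x₁) (f v) := dist_pos.2 hy₁
  have hx₁d : dist (f x₁) (f v) < dist (f z₀) (f v) / 2 := hx₁ (S.self_mem x₁)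
  obtain ⟨p, hp⟩ := S.exists_isHeight
  have hcpt : IsCompact (I x₁ ∩ f ⁻¹' {f v}) :=
    ((S.isClosed_mem x₁).inter (isClosed_singleton.preimage H.cont)).isCompact
  obtain ⟨x₀, ⟨hx₀, hfx₀⟩, hlast⟩ := hcpt.exists_isMaxOn ⟨v, S.root_mem x₁, rfl⟩
    hp.cont.continuousOn
  have hlast' : ∀ u ∈ I x₁, x₀ ∈ I u → u ≠ x₀ → f u ≠ f v := fun u hu hxu hne' hfu =>
    absurd (hp.lt hxu hne'.symm) (not_lt.2 (hlast ⟨hu, hfu⟩))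
  obtain ⟨t, ht, hft⟩ := H.exists_small_ne hd₁
  obtain ⟨e, ⟨he, hfe⟩, hmax⟩ := H.exists_maximal
    ((H.isOpen_small (dist (f x₁) (f v))).inter (isOpen_compl_singleton.preimage H.cont))
    ⟨t, ht, hft⟩
  have heball : f '' I e ⊆ Metric.ball (f v) (dist (f x₁) (f v)) := image_subset_iff.2 he
  have hx₁e : f x₁ ∉ f '' I e := fun h => by
    have h' : dist (f x₁) (f v) < dist (f x₁) (f v) := heball h
    exact lt_irrefl _ h'
  have hve : f v ∈ f '' I e := mem_image_of_mem f (S.root_mem e)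
  have hee : f e ∈ f '' I e := mem_image_of_mem f (S.self_mem e)
  have hec := H.isClosed_image (S.isClosed_mem e)
  have hep := H.preconnected_image (S.preconnected e)
  have hsub : f '' I e ⊆ f '' seg I x₀ x₁ := by
    rcases H.subset_or_subset_of_return hz hz₀ (half_lt_self hd) (half_pos hd) hec hep
      (H.isClosed_image (H.isClosed_seg x₀ x₁)) (H.preconnected_image (H.preconnected_seg hx₀))
      hve ⟨x₀, ⟨hx₀, S.self_mem x₀⟩, hfx₀⟩ (heball.trans (Metric.ball_subset_ball hx₁d.le))
      with h | h
    · exact h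
    · exact absurd (h ⟨x₁, ⟨S.self_mem x₁, hx₀⟩, rfl⟩) hx₁e
  obtain ⟨s, ⟨hs, hx₀s⟩, hse⟩ := hsub hee
  have hR : f v ∉ f '' seg I s x₁ := by
    rintro ⟨u, ⟨hu, hsu⟩, hfu⟩
    refine hlast' u hu (S.trans hsu hx₀s) ?_ hfu
    rintro rfl
    rw [S.antisymm hx₀s hsu, hfu] at hse
    exact hfe hse.symm
  rcases H.nested_or hmax (H.isClosed_image (H.isClosed_seg s x₁))
    (H.preconnected_image (H.preconnected_seg hs)) hec hep ⟨s, ⟨hs, S.self_mem s⟩, hse⟩ hee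
    with h | h | h
  · exact hx₁e (h ⟨x₁, ⟨S.self_mem x₁, hs⟩, rfl⟩)
  · exact hR (h hve)
  · exact hR (h.1 hve)

lemma image_subset_image [ConnectedSpace Y] [Nontrivial Y] (H : IsOpenLelekMap v I f) {x y : X}
    (h : f x = f y) : f '' I x ⊆ f '' I y := by
  have S := H.order
  have hvy : f v ∈ f '' I y := mem_image_of_mem f (S.root_mem y)
  obtain ⟨K, hK, hK', hxK, hfK⟩ := H.exists_lift (H.isClosed_image (S.isClosed_mem y))
    (H.preconnected_image (S.preconnected y)) (x := x) (h ▸ mem_image_of_mem f (S.self_mem y))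
  by_cases hv : v ∈ K
  · rw [← hfK]
    exact image_mono (H.least K hK hK' hv x hxK)
  obtain ⟨k, hk, hkv⟩ := hfK ▸ hvy
  rintro _ ⟨z, hz, rfl⟩
  rcases S.comparable K hK hK' hv k hk x hxK with hkx | hxk
  · rcases S.chain hkx hz with hkz | hzk
    · rw [← hfK]
      exact mem_image_of_mem f (H.seg_subset hK hK' hk hxK ⟨hz, hkz⟩)
    · rwa [H.eq_root_of_mem hkv hzk]
  · rwa [H.eq_root_of_mem hkv (S.trans hxk hz)]

lemma image_eq_image [ConnectedSpace Y] [Nontrivial Y] (H : IsOpenLelekMap v I f) {x y : X}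
    (h : f x = f y) : f '' I x = f '' I y :=
  (H.image_subset_image h).antisymm (H.image_subset_image h.symm)

lemma eq_of_mem_image [ConnectedSpace Y] [Nontrivial Y] (H : IsOpenLelekMap v I f) {x t : X}
    (ht : t ∈ I x) (h : f x ∈ f '' I t) : f t = f x := by
  have S := H.order
  obtain ⟨p, hp⟩ := S.exists_isHeight
  obtain ⟨s, hs, hsx⟩ := h
  have hcpt : IsCompact (I x ∩ f ⁻¹' {f x}) :=
    ((S.isClosed_mem x).inter (isClosed_singleton.preimage H.cont)).isCompact
  obtain ⟨m, ⟨hm, hfm⟩, hmin⟩ := hcpt.exists_isMinOn ⟨x, S.self_mem x, rfl⟩ hp.cont.continuousOn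
  have hmin' : ∀ u ∈ I m, f u = f x → u = m := fun u hu hfu => by
    by_contra hne
    exact absurd (hp.lt hu hne) (not_lt.2 (hmin ⟨S.trans hm hu, hfu⟩))
  have hms : m ∈ I s := by
    rcases S.chain hm (S.trans ht hs) with h | h
    · exact h
    · rw [hmin' s h hsx]
      exact S.self_mem m
  have hmt : m ∈ I t := S.trans hs hms
  obtain ⟨t', ht', htt'⟩ : f t ∈ f '' I m := by
    rw [H.image_eq_image (show f m = f x from hfm)]
    exact mem_image_of_mem f ht
  obtain ⟨r, hr, hfr⟩ : f m ∈ f '' I t' := by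
    rw [H.image_eq_image htt']
    exact mem_image_of_mem f hmt
  have hrm := hmin' r (S.trans ht' hr) (hfr.trans hfm)
  rw [hrm] at hr
  rw [← htt', S.antisymm ht' hr |>.symm]
  exact hfm

end IsOpenLelekMap

namespace IsOpenLelekMap

variable {X Y : Type*} [MetricSpace X] [CompactSpace X] [MetricSpace Y] {v : X}
  {I : X → Set X} {f : X → Y}

/-- A continuum missing the root is comparable with every point through which it passes. -/
lemma comparable_image (H : IsOpenLelekMap v I f) {Q : Set Y} (hQ : IsClosed Q)
    (hQ' : IsPreconnected Q) (hv : f v ∉ Q) {x y : X} (hx : f x ∈ Q) (hy : f y ∈ Q) :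
    ∃ k, f k = f y ∧ (k ∈ I x ∨ x ∈ I k) := by
  obtain ⟨K, hK, hK', hxK, rfl⟩ := H.exists_lift hQ hQ' hx
  obtain ⟨k, hk, hky⟩ := hy
  exact ⟨k, hky, H.order.comparable K hK hK' (fun h => hv ⟨v, h, rfl⟩) k hk x hxK⟩

variable [ConnectedSpace Y] [Nontrivial Y]

lemma mem_image_of_mem_image (H : IsOpenLelekMap v I f) {x y z : X} (h : f y ∈ f '' I x)
    (hz : z ∈ I y) : f z ∈ f '' I x := by
  obtain ⟨t, ht, hty⟩ := h
  obtain ⟨s, hs, hsz⟩ : f z ∈ f '' I t := H.image_eq_image hty ▸ mem_image_of_mem f hz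
  exact ⟨s, H.order.trans ht hs, hsz⟩

lemma eq_of_mem_image_of_mem_image (H : IsOpenLelekMap v I f) {x y : X} (h : f y ∈ f '' I x)
    (h' : f x ∈ f '' I y) : f x = f y := by
  obtain ⟨t, ht, hty⟩ := h
  rw [← hty]
  refine (H.eq_of_mem_image ht ?_).symm
  rwa [H.image_eq_image hty]

lemma root_notMem_image_seg (H : IsOpenLelekMap v I f) {a x : X} (ha : f a ≠ f v) :
    f v ∉ f '' seg I a x := by
  rintro ⟨t, ⟨-, hat⟩, ht⟩
  exact ha (H.eq_root_of_mem ht hat)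

lemma mem_image_of_maximal (H : IsOpenLelekMap v I f) {e x : X} (he : ∀ y, e ∈ I y → y = e)
    (hev : f e ≠ f v) (h : f e ∈ f '' I x) : f x ∈ f '' I e := by
  obtain ⟨a, ha, hae⟩ := h
  obtain ⟨k, hkx, hk | hk⟩ := H.comparable_image (H.isClosed_image (H.isClosed_seg a x))
    (H.preconnected_image (H.preconnected_seg ha)) (H.root_notMem_image_seg (hae.trans_ne hev))
    (x := e) (y := x) ⟨a, ⟨ha, H.order.self_mem a⟩, hae⟩ ⟨x, ⟨H.order.self_mem x, ha⟩, rfl⟩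
  · exact ⟨k, hk, hkx⟩
  · rw [← hkx, he k hk]
    exact mem_image_of_mem f (H.order.self_mem e)

lemma unbranched_image (H : IsOpenLelekMap v I f) {a x y : X} (hav : f a ≠ f v) (ha : a ∈ I x)
    (h : f a ∈ f '' I y) : f x ∈ f '' I y ∨ f y ∈ f '' I x := by
  have S := H.order
  obtain ⟨b, hb, hba⟩ := h
  obtain ⟨k, hkx, hk | hk⟩ := H.comparable_image (H.isClosed_image (H.isClosed_seg a x))
    (H.preconnected_image (H.preconnected_seg ha)) (H.root_notMem_image_seg hav)
    (x := b) (y := x) ⟨a, ⟨ha, S.self_mem a⟩, hba.symm⟩ ⟨x, ⟨S.self_mem x, ha⟩, rfl⟩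
  · exact Or.inl ⟨k, S.trans hb hk, hkx⟩
  · rcases S.unbranched (fun h => hav (by rw [← hba, h])) hk hb with h | h
    · exact Or.inl ⟨k, h, hkx⟩
    · exact Or.inr (H.image_eq_image hkx ▸ mem_image_of_mem f h)

/-- An open map carries a Lelek order to its image. -/
theorem exists_isLelekOrder (H : IsOpenLelekMap v I f) :
    ∃ J : Y → Set Y, IsLelekOrder (f v) J := by
  have S := H.order
  obtain ⟨Z, hZ⟩ : ∃ Z : Y → Set Y, ∀ x, Z (f x) = f '' I x :=
    ⟨fun y => f '' I (Function.surjInv H.surj y), fun x =>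
      H.image_eq_image (Function.surjInv_eq H.surj (f x))⟩
  refine ⟨Z, ?_, ?_, ?_, ?_, ?_, ?_, ?_, ?_, ?_, ?_, ?_⟩
  · refine H.surj.forall.2 fun x => ?_
    rw [hZ]
    exact mem_image_of_mem f (S.self_mem x)
  · refine H.surj.forall.2 fun x => ?_
    rw [hZ]
    exact mem_image_of_mem f (S.root_mem x)
  · intro y z h
    obtain ⟨x, rfl⟩ := H.surj y
    obtain ⟨t, rfl⟩ := H.surj z
    rw [hZ] at h
    rw [hZ, hZ]
    rintro _ ⟨s, hs, rfl⟩
    exact H.mem_image_of_mem_image h hs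
  · intro y z h h'
    obtain ⟨x, rfl⟩ := H.surj y
    obtain ⟨t, rfl⟩ := H.surj z
    rw [hZ] at h h'
    exact H.eq_of_mem_image_of_mem_image h h'
  · intro y z₁ z₂ h₁ h₂
    obtain ⟨x, rfl⟩ := H.surj y
    rw [hZ] at h₁ h₂
    obtain ⟨s, hs, rfl⟩ := h₁
    obtain ⟨t, ht, rfl⟩ := h₂
    rw [hZ, hZ]
    exact (S.chain hs ht).imp (mem_image_of_mem f) (mem_image_of_mem f)
  · intro u y z hu hy hz
    obtain ⟨x, rfl⟩ := H.surj y
    obtain ⟨x', rfl⟩ := H.surj z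
    rw [hZ] at hy hz ⊢
    obtain ⟨a, ha, rfl⟩ := hy
    rw [hZ]
    exact H.unbranched_image hu ha hz
  · refine H.surj.forall.2 fun x => ?_
    rw [hZ]
    exact H.preconnected_image (S.preconnected x)
  · convert (S.closed_graph.isCompact.image (H.cont.prodMap H.cont)).isClosed
    ext ⟨y, z⟩
    constructor
    · intro h
      obtain ⟨x, rfl⟩ := H.surj y
      obtain ⟨s, hs, rfl⟩ : z ∈ f '' I x := hZ x ▸ h
      exact ⟨(x, s), hs, rfl⟩
    · rintro ⟨⟨x, s⟩, h, heq⟩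
      obtain ⟨rfl, rfl⟩ := Prod.mk.inj heq
      change f s ∈ Z (f x)
      rw [hZ]
      exact mem_image_of_mem f h
  · intro V hV
    convert H.isOpenMap _ (S.lower _ (hV.preimage H.cont))
    ext y
    constructor
    · rintro ⟨z, hz, hzV⟩
      obtain ⟨x, rfl⟩ := H.surj y
      rw [hZ] at hz
      obtain ⟨s, hs, rfl⟩ := hz
      exact ⟨x, ⟨s, hs, hzV⟩, rfl⟩
    · rintro ⟨x, ⟨s, hs, hsV⟩, rfl⟩
      refine ⟨f s, ?_, hsV⟩
      rw [hZ]
      exact mem_image_of_mem f hs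
  · intro K hK hK' hv
    refine H.surj.forall.2 fun x hx => H.surj.forall.2 fun y hy => ?_
    obtain ⟨k, hky, h⟩ := H.comparable_image hK hK' hv hx hy
    rw [← hky, hZ, hZ]
    exact h.symm.imp (mem_image_of_mem f) (mem_image_of_mem f)
  · have := ConnectedSpace.neBot_nhdsWithin_compl_of_nontrivial_of_t1space (f v)
    refine ((H.surj.denseRange.dense_image H.cont S.dense_max).inter_of_isOpen_right
      (dense_compl_singleton (f v)) isOpen_compl_singleton).mono ?_
    rintro _ ⟨⟨e, he, rfl⟩, hev⟩
    refine H.surj.forall.2 fun x hx => ?_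
    rw [hZ] at hx
    exact H.eq_of_mem_image_of_mem_image hx (H.mem_image_of_maximal he hev hx)

end IsOpenLelekMap

lemma IsLelekFan.nonempty_homeomorph {X Y : Type*} [MetricSpace X] [MetricSpace Y] {v : X} {w : Y}
    (hX : IsLelekFan (univ : Set X) v) (hY : IsLelekFan (univ : Set Y) w) : Nonempty (X ≃ₜ Y) := by
  have := hX.compactSpace
  have := hY.compactSpace
  exact hX.isLelekOrder.nonempty_homeomorph hY.isLelekOrder hX.1.1.2.exists_ne hY.1.1.2.exists_ne

lemma IsLelekFan.image_of_isOpenMap {X Y : Type*} [MetricSpace X] [MetricSpace Y]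
    [CompactSpace Y] [ConnectedSpace Y] [Nontrivial Y] {v : X} (hX : IsLelekFan (univ : Set X) v)
    {f : X → Y} (hf : Continuous f) (hs : Function.Surjective f) (ho : IsOpenMap f) :
    ∃ w, IsLelekFan (univ : Set Y) w := by
  have := hX.compactSpace
  have H : IsOpenLelekMap v (leastContinuum v) f :=
    ⟨hX.isLelekOrder, fun K hK hK' hv x hx => leastContinuum_subset hK hK' hv hx, hf, ho, hs⟩
  obtain ⟨J, hJ⟩ := H.exists_isLelekOrder
  obtain ⟨h⟩ := hX.isLelekOrder.nonempty_homeomorph hJ hX.1.1.2.exists_ne (exists_ne _)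
  exact ⟨h v, hX.map_univ h⟩

/-- for a Lelek fan `L` and a non-degenerate continuum `Y`, TFAE:
(1) some embedding `e : Y → L` admits an open retraction of `L` onto `e(Y)`;
(2) there is an open continuous surjection `L → Y`; (3) `Y` is a Lelek fan. -/
theorem stmt16 {L Y : Type*} [MetricSpace L] [MetricSpace Y]
    [CompactSpace Y] [ConnectedSpace Y] [Nontrivial Y]
    (v : L) (hL : IsLelekFan (Set.univ : Set L) v) :
    List.TFAE
      [ ∃ e : Y → L, Topology.IsEmbedding e ∧
          ∃ r : L → L, Continuous r ∧ (∀ x, r x ∈ Set.range e) ∧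
            (∀ x ∈ Set.range e, r x = x) ∧ IsOpenOntoImage r,
        ∃ f : L → Y, Continuous f ∧ Function.Surjective f ∧ IsOpenMap f,
        ∃ w : Y, IsLelekFan (Set.univ : Set Y) w ] := by
  tfae_have 1 → 2 := by
    rintro ⟨e, he, r, hr, hre, hrid, hro⟩
    choose f hf using hre
    have hfe : ∀ y, f (e y) = y := fun y => he.injective (by rw [hf, hrid _ (mem_range_self y)])
    refine ⟨f, he.continuous_iff.2 (by convert hr using 1; exact funext hf), fun y => ⟨e y, hfe y⟩,
      fun U hU => ?_⟩
    obtain ⟨V, hV, hUV⟩ := hro U hU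
    convert hV.preimage he.continuous
    ext y
    constructor
    · rintro ⟨x, hx, rfl⟩
      rw [mem_preimage, hf]
      exact (hUV ▸ mem_image_of_mem r hx : r x ∈ V ∩ range r).1
    · intro hy
      obtain ⟨x, hx, hxy⟩ : e y ∈ r '' U := hUV ▸ ⟨hy, e y, hrid _ (mem_range_self y)⟩
      exact ⟨x, hx, he.injective (by rw [hf, hxy])⟩
  tfae_have 2 → 3 := by
    rintro ⟨f, hf, hs, ho⟩
    exact hL.image_of_isOpenMap hf hs ho
  tfae_have 3 → 1 := by
    rintro ⟨w, hw⟩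
    obtain ⟨h⟩ := hw.nonempty_homeomorph hL
    exact ⟨h, h.isEmbedding, id, continuous_id, fun x => h.surjective x, fun _ _ => rfl,
      fun U hU => ⟨U, hU, by simp⟩⟩
  tfae_finish
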